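/- Let n ≥ 3 and I ⊆ {0,…,n-1} with m_I = Σ_k ⌊(|I_k|+1)/2⌋ over the connected components I_0, I_1, …, I_s of I (with I_0 the component containing 0, possibly empty). Then the polynomial ∏_{j=2m_I+2}^{n} (1 + (-1)^{j-1} x^{⌊j/2⌋})^2 divides Σ_{σ ∈ D_n^I} (-1)^{ℓ(σ)} x^{L(σ)} in ℤ[x]. -/

import Mathlib

open Polynomial Finset

namespace OddLength

/-- A signed permutation of degree `n`, encoded as an underlying permutation of
`Fin n` together with a sign vector. -/
abbrev SP (n : ℕ) := Equiv.Perm (Fin n) × (Fin n → Bool)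

/-- The one-line value `σ(i)` of a signed permutation, for `i ∈ [1,n]` (and `0` elsewhere). -/
def sval {n : ℕ} (σ : SP n) (i : ℕ) : ℤ :=
  if h : 1 ≤ i ∧ i ≤ n then
    (if σ.2 ⟨i - 1, by omega⟩ then (-1 : ℤ) else 1) *
      (((σ.1 ⟨i - 1, by omega⟩ : Fin n) : ℕ) + 1 : ℤ)
  else 0

/-- A signed permutation is *even* (lies in the Weyl group `D_n`) if it has an even
number of negative entries in its one-line notation. -/
def IsEvenSP {n : ℕ} (σ : SP n) : Prop :=
  Even ((Finset.univ.filter (fun i => σ.2 i = true)).card)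

instance {n : ℕ} (σ : SP n) : Decidable (IsEvenSP σ) := by
  unfold IsEvenSP; infer_instance

/-- Pairs `1 ≤ i < j ≤ n` of positions. -/
def pairs (n : ℕ) : Finset (ℕ × ℕ) :=
  (Finset.Icc 1 n ×ˢ Finset.Icc 1 n).filter (fun p => p.1 < p.2)

/-- Number of inversions. -/
def invSP {n : ℕ} (σ : SP n) : ℕ :=
  ((pairs n).filter (fun p => sval σ p.2 < sval σ p.1)).card

/-- Number of negative sum pairs. -/
def nspSP {n : ℕ} (σ : SP n) : ℕ :=
  ((pairs n).filter (fun p => sval σ p.1 + sval σ p.2 < 0)).card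

/-- Number of odd inversions (positions of different parity). -/
def oinvSP {n : ℕ} (σ : SP n) : ℕ :=
  ((pairs n).filter (fun p => sval σ p.2 < sval σ p.1 ∧ p.1 % 2 ≠ p.2 % 2)).card

/-- Number of odd negative sum pairs (positions of different parity). -/
def onspSP {n : ℕ} (σ : SP n) : ℕ :=
  ((pairs n).filter (fun p => sval σ p.1 + sval σ p.2 < 0 ∧ p.1 % 2 ≠ p.2 % 2)).card

/-- The type-`D` Coxeter length `ℓ(σ) = inv(σ) + nsp(σ)`. -/
def ellD {n : ℕ} (σ : SP n) : ℕ := invSP σ + nspSP σ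

/-- The type-`D` odd length `L(σ) = oinv(σ) + onsp(σ)`. -/
def LD {n : ℕ} (σ : SP n) : ℕ := oinvSP σ + onspSP σ

/-- The descent value at position `i`, with the type-`D` convention `σ(0) := -σ(2)`. -/
def dval {n : ℕ} (σ : SP n) (i : ℕ) : ℤ := if i = 0 then -sval σ 2 else sval σ i

/-- Membership in the parabolic quotient `D_n^I`: `σ(i) < σ(i+1)` for all `i ∈ I`,
with the convention `σ(0) = -σ(2)`. -/
def InQuot {n : ℕ} (σ : SP n) (I : Finset ℕ) : Prop :=
  ∀ i ∈ I, dval σ i < dval σ (i + 1)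

instance {n : ℕ} (σ : SP n) (I : Finset ℕ) : Decidable (InQuot σ I) := by
  unfold InQuot; infer_instance

/-- `σ` is ascending: `σ(1) < σ(2) < ⋯ < σ(n)`. -/
def Ascending {n : ℕ} (σ : SP n) : Prop :=
  ∀ i, 1 ≤ i → i < n → sval σ i < sval σ (i + 1)

/-- `σ` is a chessboard element: `σ(i) ≢ σ(i+1) (mod 2)` for all `i ∈ [n-1]`. -/
def Chessboard {n : ℕ} (σ : SP n) : Prop :=
  ∀ i ∈ Finset.Icc 1 (n - 1), sval σ i % 2 ≠ sval σ (i + 1) % 2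

instance {n : ℕ} (σ : SP n) : Decidable (Chessboard σ) := by
  unfold Chessboard; infer_instance

/-- The sign-twisted generating function of the odd length over `D_n^I`. -/
noncomputable def genD (n : ℕ) (I : Finset ℕ) : Polynomial ℤ :=
  ∑ σ ∈ Finset.univ.filter (fun σ : SP n => IsEvenSP σ ∧ InQuot σ I),
    (-1 : Polynomial ℤ) ^ ellD σ * X ^ LD σ


/-- `m_I = Σ_k ⌊(|I_k|+1)/2⌋` over the connected components of `I`, computed
intrinsically: it counts the elements of `I` at even offset from the start of their
connected component. -/
def mI (I : Finset ℕ) : ℕ :=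
  (I.filter (fun i =>
    Even ((I.filter (fun j => j < i ∧ Finset.Icc j i ⊆ I)).card))).card

/-- The signed weight of an element. -/
noncomputable def wt {n : ℕ} (σ : SP n) : Polynomial ℤ :=
  (-1 : Polynomial ℤ) ^ ellD σ * X ^ LD σ

/-- The contribution of one pair of positions. -/
def cpair (v : ℕ → ℤ) (i j : ℕ) : ℕ :=
  (if v j < v i then 1 else 0) + (if v i + v j < 0 then 1 else 0)

/-- Symmetrized contribution. -/
def spair (v : ℕ → ℤ) (i j : ℕ) : ℕ :=
  if i < j then cpair v i j else cpair v j i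

lemma sval_fin {n : ℕ} (σ : SP n) (i : Fin n) :
    sval σ ((i : ℕ) + 1) = (if σ.2 i then (-1 : ℤ) else 1) * (((σ.1 i : ℕ) : ℤ) + 1) := by
  unfold sval
  rw [dif_pos ⟨by omega, by omega⟩]
  rfl

lemma ellD_eq {n : ℕ} (σ : SP n) :
    ellD σ = ∑ p ∈ pairs n, cpair (sval σ) p.1 p.2 := by
  unfold ellD invSP nspSP cpair
  rw [Finset.sum_add_distrib, Finset.card_filter, Finset.card_filter]

lemma LD_eq {n : ℕ} (σ : SP n) :
    LD σ = ∑ p ∈ pairs n, if p.1 % 2 ≠ p.2 % 2 then cpair (sval σ) p.1 p.2 else 0 := by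
  unfold LD oinvSP onspSP cpair
  rw [Finset.card_filter, Finset.card_filter, ← Finset.sum_add_distrib]
  refine Finset.sum_congr rfl fun p _ => ?_
  by_cases h : p.1 % 2 = p.2 % 2 <;> simp [h]

lemma sum_pairs {M : Type*} [AddCommMonoid M] (n : ℕ) (f : ℕ → ℕ → M) :
    ∑ p ∈ pairs n, f p.1 p.2 =
      ∑ i ∈ Finset.Icc 1 n, ∑ j ∈ Finset.Icc 1 n, if i < j then f i j else 0 := by
  unfold pairs
  rw [Finset.sum_filter, Finset.sum_product]

lemma sum_pairs_succ {M : Type*} [AddCommMonoid M] (n : ℕ) (f : ℕ → ℕ → M) :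
    ∑ p ∈ pairs (n + 1), f p.1 p.2 =
      ∑ p ∈ pairs n, f p.1 p.2 + ∑ i ∈ Finset.Icc 1 n, f i (n + 1) := by
  rw [sum_pairs, sum_pairs, Finset.sum_Icc_succ_top (by omega)]
  have h2 : ∑ j ∈ Finset.Icc 1 (n + 1), (if n + 1 < j then f (n + 1) j else 0) = 0 := by
    refine Finset.sum_eq_zero fun j hj => ?_
    rw [Finset.mem_Icc] at hj
    rw [if_neg (by omega)]
  rw [h2, add_zero, ← Finset.sum_add_distrib]
  refine Finset.sum_congr rfl fun i hi => ?_
  rw [Finset.mem_Icc] at hi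
  rw [Finset.sum_Icc_succ_top (by omega), if_pos (by omega)]

lemma sum_bip (n c : ℕ) (f : ℕ → ℕ → ℕ) :
    (∑ p ∈ pairs n, if p.1 % 2 ≠ p.2 % 2 then f p.1 p.2 else 0) =
      ∑ j ∈ Finset.Icc 1 n, ∑ i ∈ Finset.Icc 1 n,
        if i % 2 = c % 2 ∧ j % 2 ≠ c % 2 then (if i < j then f i j else f j i) else 0 := by
  rw [sum_pairs n (fun i j => if i % 2 ≠ j % 2 then f i j else 0)]
  have h1 : ∀ i ∈ Finset.Icc 1 n, ∀ j ∈ Finset.Icc 1 n,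
      (if i < j then (if i % 2 ≠ j % 2 then f i j else 0) else 0) =
      (if i % 2 = c % 2 then if i < j then (if i % 2 ≠ j % 2 then f i j else 0) else 0 else 0) +
      (if i % 2 ≠ c % 2 then
        if i < j then (if i % 2 ≠ j % 2 then f i j else 0) else 0 else 0) := by
    intro i _ j _
    by_cases h : i % 2 = c % 2 <;> simp [h]
  rw [Finset.sum_congr rfl fun i hi => Finset.sum_congr rfl (h1 i hi)]
  simp only [Finset.sum_add_distrib]
  rw [Finset.sum_comm, ← Finset.sum_add_distrib]
  refine Finset.sum_congr rfl fun j _ => ?_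
  rw [← Finset.sum_add_distrib]
  refine Finset.sum_congr rfl fun i _ => ?_
  by_cases hi : i % 2 = c % 2 <;> by_cases hj : j % 2 = c % 2 <;>
    rcases lt_trichotomy i j with h | h | h <;> 
    first
      | (subst h; simp_all)
      | (have h' := h.not_gt; simp [*]; try omega)

lemma LD_congr {n : ℕ} (σ σ' : SP n) (q r : ℕ) (hq : 1 ≤ q ∧ q ≤ n) (hr : 1 ≤ r ∧ r ≤ n)
    (hqr : q ≠ r) (hpar : q % 2 = r % 2)
    (hv : ∀ i, i ≠ q → i ≠ r → sval σ' i = sval σ i)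
    (hs : ∀ j, 1 ≤ j → j ≤ n → j % 2 ≠ q % 2 →
      spair (sval σ') q j + spair (sval σ') r j = spair (sval σ) q j + spair (sval σ) r j) :
    LD σ' = LD σ := by
  rw [LD_eq, LD_eq, sum_bip n q, sum_bip n q]
  refine Finset.sum_congr rfl fun j hj => ?_
  rw [Finset.mem_Icc] at hj
  have hqm : q ∈ Finset.Icc 1 n := Finset.mem_Icc.2 hq
  have hrm : r ∈ (Finset.Icc 1 n).erase q :=
    Finset.mem_erase.2 ⟨hqr.symm, Finset.mem_Icc.2 hr⟩
  rw [← Finset.add_sum_erase _ _ hqm, ← Finset.add_sum_erase _ _ hrm,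
    ← Finset.add_sum_erase _ _ hqm, ← Finset.add_sum_erase _ _ hrm]
  rw [← add_assoc, ← add_assoc]
  congr 1
  · by_cases hj2 : j % 2 = q % 2
    · simp [hj2]
    · have := hs j hj.1 hj.2 hj2
      unfold spair at this
      simp only [hj2, hpar.symm, ne_eq, not_false_eq_true, and_self, if_true]
      exact this
  · refine Finset.sum_congr rfl fun i hi => ?_
    simp only [Finset.mem_erase] at hi
    by_cases hj2 : j % 2 = q % 2
    · simp [hj2]
    · have hjq : j ≠ q := fun h => hj2 (by rw [h])
      have hjr : j ≠ r := fun h => hj2 (by rw [h, hpar])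
      unfold cpair
      rw [hv i hi.2.1 hi.1, hv j hjq hjr]

lemma Icc_sum_fin {M : Type*} [CommMonoid M] (n : ℕ) (f : ℕ → M) :
    ∏ i ∈ Finset.Icc 1 n, f i = ∏ i : Fin n, f ((i : ℕ) + 1) := by
  rw [Fin.prod_univ_eq_prod_range (fun i => f (i + 1)) n]
  induction n with
  | zero => simp
  | succ k ih => rw [Finset.prod_Icc_succ_top (by omega), Finset.prod_range_succ, ih]

lemma cpair_par {n : ℕ} (σ : SP n) (i j : Fin n) (hij : i ≠ j) :
    (-1 : ℤ) ^ cpair (sval σ) ((i : ℕ) + 1) ((j : ℕ) + 1) =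
      if σ.1 i < σ.1 j then 1 else -1 := by
  have hne : ((σ.1 i : Fin n) : ℕ) ≠ (σ.1 j : ℕ) := fun h => hij (σ.1.injective (Fin.ext h))
  unfold cpair
  simp only [sval_fin, Fin.lt_def]
  generalize ((σ.1 i : Fin n) : ℕ) = a at *
  generalize ((σ.1 j : Fin n) : ℕ) = b at *
  cases σ.2 i <;> cases σ.2 j <;> simp <;> split_ifs <;> omega

lemma ell_sign {n : ℕ} (σ : SP n) :
    (-1 : ℤ) ^ ellD σ = ((Equiv.Perm.sign σ.1 : ℤˣ) : ℤ) := by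
  rw [ellD_eq, ← Finset.prod_pow_eq_pow_sum, Equiv.Perm.sign_eq_prod_prod_Ioi]
  unfold pairs
  rw [Finset.prod_filter, Finset.prod_product, Icc_sum_fin]
  push_cast
  refine Finset.prod_congr rfl fun i _ => ?_
  rw [Icc_sum_fin, ← Finset.filter_lt_eq_Ioi, Finset.prod_filter]
  refine Finset.prod_congr rfl fun j _ => ?_
  by_cases h : i < j
  · have h' : (i : ℕ) + 1 < (j : ℕ) + 1 := by simpa using h
    simp only [h, h', if_true]
    rw [cpair_par σ i j h.ne]
    split_ifs <;> simp
  · have h' : ¬ (i : ℕ) + 1 < (j : ℕ) + 1 := by simpa using h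
    simp only [h, h', if_false]

lemma wt_neg {n : ℕ} (σ σ' : SP n) (hL : LD σ' = LD σ)
    (hs : Equiv.Perm.sign σ'.1 = - Equiv.Perm.sign σ.1) : wt σ' = - wt σ := by
  have h : (-1 : ℤ) ^ ellD σ' = - (-1 : ℤ) ^ ellD σ := by
    rw [ell_sign, ell_sign, hs]; simp
  have h2 := congrArg (Int.cast : ℤ → Polynomial ℤ) h
  push_cast at h2
  unfold wt
  rw [hL, h2]; ring

lemma sum_zero_of_swap {n : ℕ} (s : Finset (SP n)) (f : SP n → SP n)
    (hf : ∀ σ ∈ s, f σ ∈ s) (hff : ∀ σ ∈ s, f (f σ) = σ) (hw : ∀ σ ∈ s, wt (f σ) = - wt σ) :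
    ∑ σ ∈ s, wt σ = 0 := by
  have h : ∑ σ ∈ s, wt σ = ∑ σ ∈ s, - wt σ := by
    refine Finset.sum_bij' (fun σ _ => f σ) (fun σ _ => f σ) hf hf hff hff ?_
    intro σ hσ
    rw [hw σ hσ, neg_neg]
  rw [Finset.sum_neg_distrib] at h
  exact self_eq_neg.1 h

/-- Swap the entries in positions `q` and `r`. -/
def posSwap {n : ℕ} (q r : Fin n) (σ : SP n) : SP n :=
  (σ.1 * Equiv.swap q r, σ.2 ∘ Equiv.swap q r)

lemma posSwap_posSwap {n : ℕ} (q r : Fin n) (σ : SP n) : posSwap q r (posSwap q r σ) = σ := by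
  unfold posSwap
  ext i
  · simp
  · simp

lemma sval_posSwap_left {n : ℕ} (q r : Fin n) (σ : SP n) :
    sval (posSwap q r σ) ((q : ℕ) + 1) = sval σ ((r : ℕ) + 1) := by
  rw [sval_fin, sval_fin]; simp [posSwap]

lemma sval_posSwap_right {n : ℕ} (q r : Fin n) (σ : SP n) :
    sval (posSwap q r σ) ((r : ℕ) + 1) = sval σ ((q : ℕ) + 1) := by
  rw [sval_fin, sval_fin]; simp [posSwap]

lemma sval_out {n : ℕ} (σ : SP n) (i : ℕ) (h : ¬ (1 ≤ i ∧ i ≤ n)) : sval σ i = 0 := by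
  unfold sval; rw [dif_neg h]

lemma sval_posSwap_of_ne {n : ℕ} (q r : Fin n) (σ : SP n) (i : ℕ) (hq : i ≠ (q : ℕ) + 1)
    (hr : i ≠ (r : ℕ) + 1) : sval (posSwap q r σ) i = sval σ i := by
  by_cases h : 1 ≤ i ∧ i ≤ n
  · obtain ⟨k, rfl⟩ : ∃ k : Fin n, i = (k : ℕ) + 1 := ⟨⟨i - 1, by omega⟩, by simp; omega⟩
    rw [sval_fin, sval_fin]
    have h1 : k ≠ q := fun h => hq (by rw [h])
    have h2 : k ≠ r := fun h => hr (by rw [h])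
    simp [posSwap, Equiv.swap_apply_of_ne_of_ne h1 h2]
  · rw [sval_out _ _ h, sval_out _ _ h]

open Classical in
lemma Tq_zero (n : ℕ) (J : Finset ℕ) (q r s t : ℕ) (hsq : s ≤ q) (hqt : q ≤ t) (hs1 : 1 ≤ s)
    (htn : t ≤ n) (hrst : r + 1 = s ∨ r = t + 1) (hr1 : 1 ≤ r) (hrn : r ≤ n)
    (hpar : q % 2 = r % 2) (hsJ : s - 1 ∉ J) (htJ : t ∉ J) (hrJ : r ∉ J) (hrJ' : r - 1 ∉ J)
    (h0 : 0 ∈ J → 3 ≤ s ∧ 3 ≤ r) :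
    ∑ σ ∈ Finset.univ.filter (fun σ : SP n => InQuot σ J ∧
      (∀ j, s ≤ j → j < q → sval σ j < sval σ r ∧ sval σ j < sval σ q) ∧
      (∀ j, q < j → j ≤ t → sval σ r < sval σ j ∧ sval σ q < sval σ j)), wt σ = 0 := by
  obtain ⟨q', rfl⟩ : ∃ k : Fin n, q = (k : ℕ) + 1 := ⟨⟨q - 1, by omega⟩, by simp; omega⟩
  obtain ⟨r', rfl⟩ : ∃ k : Fin n, r = (k : ℕ) + 1 := ⟨⟨r - 1, by omega⟩, by simp; omega⟩
  refine sum_zero_of_swap _ (posSwap q' r') ?_ (fun σ _ => posSwap_posSwap q' r' σ) ?_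
  · intro σ hσ
    simp only [Finset.mem_filter, Finset.mem_univ, true_and] at hσ ⊢
    obtain ⟨hQ, hl, hu⟩ := hσ
    rw [sval_posSwap_left, sval_posSwap_right]
    refine ⟨?_, ?_, ?_⟩
    · intro i hi
      have hi' := hQ i hi
      by_cases hi0 : i = 0
      · subst hi0
        have := h0 hi
        unfold dval at hi' ⊢
        simp only [if_true, zero_add, one_ne_zero, if_false] at hi' ⊢
        rw [sval_posSwap_of_ne _ _ _ _ (by omega) (by omega),
          sval_posSwap_of_ne _ _ _ _ (by omega) (by omega)]
        exact hi'
      · unfold dval at hi' ⊢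
        simp only [hi0, Nat.add_eq_zero_iff, one_ne_zero, and_false, if_false] at hi' ⊢
        have e1 : i ≠ (r' : ℕ) + 1 := fun h => hrJ (h ▸ hi)
        have e2 : i + 1 ≠ (r' : ℕ) + 1 := fun h => hrJ' (by rw [← h]; simpa using hi)
        have e3 : i ≠ t := fun h => htJ (h ▸ hi)
        have e4 : i + 1 ≠ s := fun h => hsJ (by rw [← h]; simpa using hi)
        by_cases e5 : i = (q' : ℕ) + 1
        · subst e5
          rw [sval_posSwap_left, sval_posSwap_of_ne _ _ _ _ (by omega) (by omega)]
          exact (hu _ (by omega) (by omega)).1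
        · by_cases e6 : i + 1 = (q' : ℕ) + 1
          · rw [e6, sval_posSwap_left, sval_posSwap_of_ne _ _ _ _ (by omega) (by omega)]
            exact (hl _ (by omega) (by omega)).1
          · rw [sval_posSwap_of_ne _ _ _ _ (by omega) (by omega),
              sval_posSwap_of_ne _ _ _ _ (by omega) (by omega)]
            exact hi'
    · intro j h1 h2
      rw [sval_posSwap_of_ne _ _ _ _ (by omega) (by omega)]
      exact (hl j h1 h2).symm
    · intro j h1 h2
      rw [sval_posSwap_of_ne _ _ _ _ (by omega) (by omega)]
      exact (hu j h1 h2).symm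
  · intro σ hσ
    simp only [Finset.mem_filter, Finset.mem_univ, true_and] at hσ
    obtain ⟨hQ, hl, hu⟩ := hσ
    have hne : q' ≠ r' := by rintro rfl; omega
    refine wt_neg _ _ ?_ ?_
    · refine LD_congr σ _ ((q' : ℕ) + 1) ((r' : ℕ) + 1) (by omega) (by omega) (by omega) hpar
        (fun i h1 h2 => sval_posSwap_of_ne _ _ _ _ h1 h2) ?_
      intro j h1 h2 h3
      have h4 : j ≠ (q' : ℕ) + 1 := fun h => h3 (by rw [h])
      have h5 : j ≠ (r' : ℕ) + 1 := fun h => h3 (by rw [h, hpar])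
      unfold spair cpair
      rw [sval_posSwap_left, sval_posSwap_right, sval_posSwap_of_ne _ _ _ _ h4 h5]
      have hl' := hl j
      have hu' := hu j
      generalize sval σ j = a at *
      generalize sval σ ((q' : ℕ) + 1) = b at *
      generalize sval σ ((r' : ℕ) + 1) = c at *
      by_cases hjq : (q' : ℕ) + 1 < j <;> by_cases hjr : (r' : ℕ) + 1 < j
      · simp only [hjq, hjr, if_true]; ring
      · have := hu' hjq (by omega)
        simp only [hjq, hjr, if_true, if_false]
        have g1 : a < b ↔ False := by simp; omega
        have g2 : a < c ↔ False := by simp; omega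
        have g3 : b < a ↔ True := by simp; omega
        have g4 : c < a ↔ True := by simp; omega
        simp only [g1, g2, g3, g4, if_true, if_false, add_comm]
        ring
      · have := hl' (by omega) (by omega)
        simp only [hjq, hjr, if_true, if_false]
        have g1 : a < b ↔ True := by simp; omega
        have g2 : a < c ↔ True := by simp; omega
        have g3 : b < a ↔ False := by simp; omega
        have g4 : c < a ↔ False := by simp; omega
        simp only [g1, g2, g3, g4, if_true, if_false, add_comm]
        ring
      · simp only [hjq, hjr, if_false]; ring
    · simp [posSwap, Equiv.Perm.sign_swap hne]

/-- Sum of weights over all signed permutations in the quotient. -/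
noncomputable def tot (n : ℕ) (I : Finset ℕ) : Polynomial ℤ :=
  ∑ σ ∈ Finset.univ.filter (fun σ : SP n => InQuot σ I), wt σ

lemma sval_ne {n : ℕ} (σ : SP n) (i j : ℕ) (hi : 1 ≤ i ∧ i ≤ n) (hj : 1 ≤ j ∧ j ≤ n)
    (hij : i ≠ j) : sval σ i ≠ sval σ j := by
  obtain ⟨a, rfl⟩ : ∃ k : Fin n, i = (k : ℕ) + 1 := ⟨⟨i - 1, by omega⟩, by simp; omega⟩
  obtain ⟨b, rfl⟩ : ∃ k : Fin n, j = (k : ℕ) + 1 := ⟨⟨j - 1, by omega⟩, by simp; omega⟩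
  rw [sval_fin, sval_fin]
  have hne : ((σ.1 a : Fin n) : ℕ) ≠ (σ.1 b : ℕ) := fun h =>
    hij (by rw [σ.1.injective (Fin.ext h)])
  split_ifs <;> omega

/-- strictly increasing along an interval of constraints. -/
lemma chain_lt {n : ℕ} (σ : SP n) (J : Finset ℕ) (hQ : InQuot σ J) (s t : ℕ) (hs : 1 ≤ s)
    (hJ : ∀ i, s ≤ i → i < t → i ∈ J) (i j : ℕ) (hsi : s ≤ i) (hij : i < j) (hjt : j ≤ t) :
    sval σ i < sval σ j := by
  induction j, hij using Nat.le_induction with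
  | base =>
    have := hQ i (hJ i hsi (by omega))
    unfold dval at this
    simpa [show i ≠ 0 by omega] using this
  | succ k hk ih =>
    have h1 := ih (by omega)
    have := hQ k (hJ k (by omega) (by omega))
    unfold dval at this
    simp only [show k ≠ 0 by omega, Nat.add_eq_zero_iff, one_ne_zero, and_false, if_false] at this
    omega

open Classical in
/-- General form of the dropping lemma; `J` has the chain `[s,t]`, and `r` is a free
neighbouring position; elements with the wrong comparison cancel. -/
lemma drop_zero (n : ℕ) (J : Finset ℕ) (r s t : ℕ) (hs1 : 1 ≤ s)
    (htn : t ≤ n) (hrst : r + 1 = s ∨ r = t + 1) (hr1 : 1 ≤ r) (hrn : r ≤ n)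
    (hpar : (t + 1 - s) % 2 = 0) (hst : s < t)
    (hsJ : s - 1 ∉ J) (htJ : t ∉ J) (hrJ : r ∉ J) (hrJ' : r - 1 ∉ J)
    (h0 : 0 ∈ J → 3 ≤ s ∧ 3 ≤ r) (hJ : ∀ i, s ≤ i → i < t → i ∈ J) :
    ∑ σ ∈ Finset.univ.filter (fun σ : SP n => InQuot σ J ∧
      ((r + 1 = s ∧ sval σ s < sval σ r) ∨ (r = t + 1 ∧ sval σ r < sval σ t))), wt σ = 0 := by
  set T : ℕ → Finset (SP n) := fun q => Finset.univ.filter (fun σ : SP n => InQuot σ J ∧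
      (∀ j, s ≤ j → j < q → sval σ j < sval σ r ∧ sval σ j < sval σ q) ∧
      (∀ j, q < j → j ≤ t → sval σ r < sval σ j ∧ sval σ q < sval σ j)) with hT
  have hU : Finset.univ.filter (fun σ : SP n => InQuot σ J ∧
      ((r + 1 = s ∧ sval σ s < sval σ r) ∨ (r = t + 1 ∧ sval σ r < sval σ t))) =
      ((Finset.Icc s t).filter (fun q => q % 2 = r % 2)).biUnion T := by
    ext σ
    simp only [Finset.mem_filter, Finset.mem_univ, true_and, Finset.mem_biUnion, Finset.mem_Icc,
      hT]
    constructor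
    · rintro ⟨hQ, hc⟩
      have hch := chain_lt σ J hQ s t hs1 hJ
      have hne := fun j (h : s ≤ j ∧ j ≤ t) =>
        sval_ne σ j r (by omega) (by omega) (show j ≠ r by omega)
      -- number of the chain elements below the free one
      obtain ⟨m, hm1, hm2, hml, hmu⟩ : ∃ m, s ≤ m ∧ m ≤ t + 1 ∧
          (∀ j, s ≤ j → j < m → sval σ j < sval σ r) ∧
          (∀ j, m ≤ j → j ≤ t → sval σ r < sval σ j) := by
        by_cases hex : ∃ j, s ≤ j ∧ j ≤ t ∧ sval σ r < sval σ j
        · refine ⟨Nat.find hex, (Nat.find_spec hex).1, by have := (Nat.find_spec hex).2.1; omega,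
            ?_, ?_⟩
          · intro j h1 h2
            have h3 := Nat.find_min hex h2
            have h4 := (Nat.find_spec hex).2.1
            have h5 := hne j ⟨h1, by omega⟩
            by_contra h6
            exact h3 ⟨h1, by omega, by omega⟩
          · intro j h1 h2
            have h3 := (Nat.find_spec hex)
            rcases h1.eq_or_lt with h | h
            · rw [← h]; exact h3.2.2
            · exact h3.2.2.trans (hch _ _ h3.1 h h2)
        · refine ⟨t + 1, by omega, le_rfl, ?_, ?_⟩
          · intro j h1 h2
            have h5 := hne j ⟨h1, by omega⟩
            by_contra h6
            exact hex ⟨j, h1, by omega, by omega⟩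
          · intro j h1 h2; omega
      have key : ∃ q, s ≤ q ∧ q ≤ t ∧ q % 2 = r % 2 ∧ (q = m ∨ q + 1 = m) := by
        by_cases hmr : m % 2 = r % 2
        · refine ⟨m, hm1, ?_, hmr, Or.inl rfl⟩
          rcases hc with ⟨h1, h2⟩ | ⟨h1, h2⟩
          · omega
          · by_contra h3
            have := hml t (by omega) (by omega)
            omega
        · refine ⟨m - 1, ?_, by omega, by omega, ?_⟩
          · rcases hc with ⟨h1, h2⟩ | ⟨h1, h2⟩
            · by_contra h3
              have := hmu s (by omega) (by omega)
              omega
            · omega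
          · right
            rcases hc with ⟨h1, h2⟩ | ⟨h1, h2⟩
            · omega
            · omega
      obtain ⟨q, hq1, hq2, hq3, hq4⟩ := key
      refine ⟨q, ⟨⟨hq1, hq2⟩, hq3⟩, hQ, ?_, ?_⟩
      · intro j h1 h2
        exact ⟨hml j h1 (by omega), hch j q h1 h2 hq2⟩
      · intro j h1 h2
        exact ⟨hmu j (by omega) h2, hch q j hq1 h1 h2⟩
    · rintro ⟨q, ⟨⟨h1, h2⟩, h3⟩, hQ, hl, hu⟩
      refine ⟨hQ, ?_⟩
      rcases hrst with h | h
      · exact Or.inl ⟨h, (hl s le_rfl (by omega)).1⟩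
      · exact Or.inr ⟨h, (hu t (by omega) le_rfl).1⟩
  rw [hU, Finset.sum_biUnion]
  · refine Finset.sum_eq_zero fun q hq => ?_
    simp only [Finset.mem_filter, Finset.mem_Icc] at hq
    exact Tq_zero n J q r s t hq.1.1 hq.1.2 hs1 htn hrst hr1 hrn hq.2 hsJ htJ hrJ hrJ' h0
  · have aux : ∀ q q', s ≤ q → q' ≤ t → q % 2 = r % 2 → q' % 2 = r % 2 → q < q' →
        Disjoint (T q) (T q') := by
      intro q q' h1 h2 h3 h4 h5
      rw [Finset.disjoint_left]
      intro σ ha hb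
      simp only [hT, Finset.mem_filter, Finset.mem_univ, true_and] at ha hb
      have := (ha.2.2 (q + 1) (by omega) (by omega)).1
      have := (hb.2.1 (q + 1) (by omega) (by omega)).1
      omega
    intro q hq q' hq' hne
    simp only [Finset.coe_filter, Finset.mem_Icc, Set.mem_ofPred_eq] at hq hq'
    rcases lt_or_gt_of_ne hne with h | h
    · exact aux q q' hq.1.1 hq'.1.2 hq.2 hq'.2 h
    · exact (aux q' q hq'.1.1 hq.1.2 hq'.2 hq.2 h).symm

open Classical in
lemma tot_erase (n : ℕ) (I : Finset ℕ) (e : ℕ) (he : e ∈ I) (he1 : 1 ≤ e) (hen : e + 1 ≤ n)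
    (h : ∑ σ ∈ Finset.univ.filter (fun σ : SP n => InQuot σ (I.erase e) ∧
      sval σ (e + 1) < sval σ e), wt σ = 0) : tot n (I.erase e) = tot n I := by
  unfold tot
  rw [← Finset.sum_filter_add_sum_filter_not (Finset.univ.filter
    (fun σ : SP n => InQuot σ (I.erase e))) (fun σ => sval σ (e + 1) < sval σ e)]
  rw [Finset.filter_filter, h, zero_add, Finset.filter_filter]
  refine Finset.sum_congr ?_ fun _ _ => rfl
  ext σ
  simp only [Finset.mem_filter, Finset.mem_univ, true_and]
  have hne := sval_ne σ e (e + 1) (by omega) (by omega) (by omega)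
  constructor
  · rintro ⟨hQ, hd⟩ i hi
    by_cases hie : i = e
    · subst hie
      unfold dval
      simp only [show i ≠ 0 by omega, Nat.add_eq_zero_iff, one_ne_zero, and_false, if_false]
      omega
    · exact hQ i (Finset.mem_erase.2 ⟨hie, hi⟩)
  · intro hQ
    refine ⟨fun i hi => hQ i (Finset.mem_of_mem_erase hi), ?_⟩
    have := hQ e he
    unfold dval at this
    simp only [show e ≠ 0 by omega, Nat.add_eq_zero_iff, one_ne_zero, and_false, if_false] at this
    omega

/-- `[s,e]` a component of even size, drop its last element. -/
lemma drop_last (n : ℕ) (I : Finset ℕ) (s e : ℕ) (hs : 1 ≤ s) (hse : s < e)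
    (hpar : (e - s) % 2 = 1) (hen : e + 1 ≤ n) (hI : ∀ i, s ≤ i → i ≤ e → i ∈ I)
    (hsI : s - 1 ∉ I) (heI : e + 1 ∉ I) (h0 : 0 ∈ I → 3 ≤ s) :
    tot n (I.erase e) = tot n I := by
  refine tot_erase n I e (hI e (by omega) le_rfl) (by omega) hen ?_
  have := drop_zero n (I.erase e) (e + 1) s e hs (by omega) (Or.inr rfl) (by omega) hen
    (by omega) hse (fun h => hsI (Finset.mem_of_mem_erase h)) (by simp)
    (fun h => heI (Finset.mem_of_mem_erase h)) (by simp)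
    (fun h => by have := h0 (Finset.mem_of_mem_erase h); omega)
    (fun i h1 h2 => Finset.mem_erase.2 ⟨by omega, hI i h1 (by omega)⟩)
  convert this using 5 with σ
  simp only [true_and]
  constructor
  · exact Or.inr
  · rintro (⟨h, _⟩ | h)
    · omega
    · exact h

/-- `[s,e]` a component of even size, drop its first element. -/
lemma drop_first (n : ℕ) (I : Finset ℕ) (s e : ℕ) (hs : 1 ≤ s) (hse : s < e)
    (hpar : (e - s) % 2 = 1) (hen : e + 1 ≤ n) (hI : ∀ i, s ≤ i → i ≤ e → i ∈ I)
    (hsI : s - 1 ∉ I) (heI : e + 1 ∉ I) (h0 : 0 ∈ I → 3 ≤ s) :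
    tot n (I.erase s) = tot n I := by
  refine tot_erase n I s (hI s le_rfl (by omega)) (by omega) (by omega) ?_
  have := drop_zero n (I.erase s) s (s + 1) (e + 1) (by omega) (by omega) (Or.inl rfl) (by omega)
    (by omega) (by omega) (by omega) (by simp) (fun h => heI (Finset.mem_of_mem_erase h))
    (by simp) (fun h => hsI (Finset.mem_of_mem_erase h))
    (fun h => by have := h0 (Finset.mem_of_mem_erase h); omega)
    (fun i h1 h2 => Finset.mem_erase.2 ⟨by omega, hI i (by omega) (by omega)⟩)
  convert this using 5 with σ
  simp only [true_and]
  constructor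
  · exact Or.inl
  · rintro (h | ⟨h, _⟩)
    · exact h
    · omega

/-- `i` is at even offset in its component of `I`. -/
def Sel (I : Finset ℕ) (i : ℕ) : Prop :=
  Even ((I.filter (fun j => j < i ∧ Finset.Icc j i ⊆ I)).card)

/-- `s` starts the component of `i`. -/
def Start (I : Finset ℕ) (s i : ℕ) : Prop :=
  s ≤ i ∧ (∀ j, s ≤ j → j ≤ i → j ∈ I) ∧ (s = 0 ∨ s - 1 ∉ I)

lemma sel_iff {I : Finset ℕ} {s i : ℕ} (h : Start I s i) : Sel I i ↔ (i - s) % 2 = 0 := by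
  unfold Sel
  have : I.filter (fun j => j < i ∧ Finset.Icc j i ⊆ I) = Finset.Ico s i := by
    ext j
    simp only [Finset.mem_filter, Finset.mem_Ico]
    obtain ⟨h1, h2, h3⟩ := h
    constructor
    · rintro ⟨hj, hji, hs⟩
      refine ⟨?_, hji⟩
      by_contra hlt
      rcases h3 with h3 | h3
      · omega
      · exact h3 (hs (Finset.mem_Icc.2 ⟨by omega, by omega⟩))
    · rintro ⟨ha, hb⟩
      refine ⟨h2 j ha (by omega), hb, fun k hk => ?_⟩
      rw [Finset.mem_Icc] at hk
      exact h2 k (by omega) hk.2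
  rw [this, Nat.card_Ico, Nat.even_iff]

lemma exists_start (I : Finset ℕ) (i : ℕ) (hi : i ∈ I) : ∃ s, Start I s i := by
  induction i with
  | zero => exact ⟨0, le_rfl, fun j _ h => by rw [Nat.le_zero.1 h]; exact hi, Or.inl rfl⟩
  | succ k ih =>
    by_cases hk : k ∈ I
    · obtain ⟨s, h1, h2, h3⟩ := ih hk
      refine ⟨s, by omega, fun j ha hb => ?_, h3⟩
      rcases Nat.lt_or_ge k j with h | h
      · have : j = k + 1 := by omega
        rwa [this]
      · exact h2 j ha h
    · exact ⟨k + 1, le_rfl, fun j ha hb => by rw [le_antisymm hb ha]; exact hi, Or.inr (by simpa)⟩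

lemma exists_end (I : Finset ℕ) (i : ℕ) (hi : i ∈ I) :
    ∃ e, i ≤ e ∧ (∀ j, i ≤ j → j ≤ e → j ∈ I) ∧ e + 1 ∉ I := by
  have hex : ∃ e, i ≤ e ∧ e + 1 ∉ I := by
    refine ⟨I.sup id + i, by omega, fun h => ?_⟩
    have := Finset.le_sup (f := id) h
    simp only [id] at this
    omega
  classical
  refine ⟨Nat.find hex, (Nat.find_spec hex).1, ?_, (Nat.find_spec hex).2⟩
  intro j h1 h2
  by_contra hj
  have hji : j ≠ i := fun h => hj (h ▸ hi)
  exact Nat.find_min hex (m := j - 1) (by omega)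
    ⟨by omega, by rwa [show j - 1 + 1 = j by omega]⟩

open Classical in
lemma mI_eq (I : Finset ℕ) : mI I = (I.filter (fun i => Sel I i)).card := by
  unfold mI Sel
  congr

lemma mI_erase (I : Finset ℕ) (e : ℕ) (heI : e + 1 ∉ I) : mI (I.erase e) ≤ mI I := by
  classical
  rw [mI_eq, mI_eq]
  refine Finset.card_le_card fun i hi => ?_
  simp only [Finset.mem_filter] at hi ⊢
  obtain ⟨hi1, hi2⟩ := hi
  refine ⟨Finset.mem_of_mem_erase hi1, ?_⟩
  obtain ⟨s, hs⟩ := exists_start _ _ hi1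
  rw [sel_iff hs] at hi2
  obtain ⟨h1, h2, h3⟩ := hs
  have hst : Start I s i := by
    refine ⟨h1, fun j ha hb => Finset.mem_of_mem_erase (h2 j ha hb), ?_⟩
    rcases h3 with h3 | h3
    · exact Or.inl h3
    · by_cases h0 : s = 0
      · exact Or.inl h0
      right
      intro h
      have : s - 1 = e := by
        by_contra hne
        exact h3 (Finset.mem_erase.2 ⟨hne, h⟩)
      have h4 := Finset.mem_of_mem_erase (h2 s le_rfl h1)
      rw [show s = e + 1 by omega] at h4
      exact heI h4
  rw [sel_iff hst]; exact hi2

lemma mI_shift (I : Finset ℕ) (s e : ℕ) (hs : 2 ≤ s) (hse : s ≤ e)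
    (hI : ∀ i, s ≤ i → i ≤ e → i ∈ I) (h1I : s - 1 ∉ I) (h2I : s - 2 ∉ I) (heI : e + 1 ∉ I) :
    mI ((insert (s - 1) I).erase e) ≤ mI I := by
  classical
  rw [mI_eq, mI_eq]
  refine Finset.card_le_card_of_injOn (fun x => if s - 1 ≤ x ∧ x ≤ e then x + 1 else x) ?_ ?_
  · intro x hx
    simp only [Finset.coe_filter, Set.mem_ofPred_eq] at hx ⊢
    obtain ⟨hx1, hx2⟩ := hx
    have hx3 := Finset.mem_erase.1 hx1
    split_ifs with hc
    · have hxe : x + 1 ≤ e := by omega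
      have st1 : Start ((insert (s - 1) I).erase e) (s - 1) x := by
        refine ⟨by omega, fun j ha hb => ?_, Or.inr ?_⟩
        · refine Finset.mem_erase.2 ⟨by omega, ?_⟩
          by_cases hj : j = s - 1
          · rw [hj]; simp
          · exact Finset.mem_insert_of_mem (hI j (by omega) (by omega))
        · simp only [Finset.mem_erase, Finset.mem_insert, not_and, not_or]
          intro _
          exact ⟨by omega, by rwa [show s - 1 - 1 = s - 2 by omega]⟩
      have st2 : Start I s (x + 1) :=
        ⟨by omega, fun j ha hb => hI j ha (by omega), Or.inr h1I⟩
      rw [sel_iff st1] at hx2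
      refine ⟨hI _ (by omega) hxe, ?_⟩
      rw [sel_iff st2]
      omega
    · have hxI : x ∈ I := by
        rcases Finset.mem_insert.1 hx3.2 with h | h
        · omega
        · exact h
      refine ⟨hxI, ?_⟩
      obtain ⟨s', hs'⟩ := exists_start _ _ hx1
      rw [sel_iff hs'] at hx2
      obtain ⟨h1, h2, h3⟩ := hs'
      have hlow : x < s' ∨ x < s - 1 ∨ e < s' := by
        by_contra hcon
        have := h2 e (by omega) (by omega)
        simp at this
      have st : Start I s' x := by
        refine ⟨h1, fun j ha hb => ?_, ?_⟩
        · rcases Finset.mem_insert.1 (Finset.mem_of_mem_erase (h2 j ha hb)) with h | h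
          · omega
          · exact h
        · by_cases h0 : s' = 0
          · exact Or.inl h0
          right
          intro h
          have h3' := h3.resolve_left h0
          have : s' - 1 = e := by
            by_contra hne
            exact h3' (Finset.mem_erase.2 ⟨hne, Finset.mem_insert_of_mem h⟩)
          have h4 := Finset.mem_of_mem_erase (h2 s' le_rfl h1)
          rw [show s' = e + 1 by omega] at h4
          rcases Finset.mem_insert.1 h4 with h5 | h5
          · omega
          · exact heI h5
      rw [sel_iff st]; exact hx2
  · intro x hx y hy hxy
    simp only [Finset.coe_filter, Set.mem_ofPred_eq, Finset.mem_erase, Finset.mem_insert] at hx hy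
    have hx4 : x ≠ e + 1 := by
      rintro rfl
      rcases hx.1.2 with h | h
      · omega
      · exact heI h
    have hy4 : y ≠ e + 1 := by
      rintro rfl
      rcases hy.1.2 with h | h
      · omega
      · exact heI h
    dsimp only at hxy
    split_ifs at hxy <;> omega

open Classical in
/-- Number of selected elements up to `i`. -/
noncomputable def cnt (I : Finset ℕ) (i : ℕ) : ℕ :=
  (I.filter (fun x => Sel I x ∧ x ≤ i)).card

lemma cnt_mono (I : Finset ℕ) {x y : ℕ} (h : x ≤ y) : cnt I x ≤ cnt I y := by
  classical
  unfold cnt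
  refine Finset.card_le_card fun z hz => ?_
  simp only [Finset.mem_filter] at hz ⊢
  exact ⟨hz.1, hz.2.1, by omega⟩

lemma cnt_le (I : Finset ℕ) (x : ℕ) : cnt I x ≤ mI I := by
  classical
  rw [mI_eq]
  unfold cnt
  refine Finset.card_le_card fun z hz => ?_
  simp only [Finset.mem_filter] at hz ⊢
  exact ⟨hz.1, hz.2.1⟩

lemma cnt_lt (I : Finset ℕ) {x y : ℕ} (h : x < y) (hy : y ∈ I) (hs : Sel I y) :
    cnt I x + 1 ≤ cnt I y := by
  classical
  unfold cnt
  refine Finset.card_lt_card ?_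
  rw [Finset.ssubset_iff_of_subset]
  · exact ⟨y, by simp [hy, hs], by simp; omega⟩
  · intro z hz
    simp only [Finset.mem_filter] at hz ⊢
    exact ⟨hz.1, hz.2.1, by omega⟩

lemma cnt_pos (I : Finset ℕ) {y : ℕ} (hy : y ∈ I) (hs : Sel I y) : 1 ≤ cnt I y := by
  classical
  unfold cnt
  exact Finset.card_pos.2 ⟨y, by simp [hy, hs]⟩

lemma cnt_chain (I : Finset ℕ) {s i : ℕ} (h : Start I s i) : cnt I s + (i - s) / 2 ≤ cnt I i := by
  have key : ∀ d, s + 2 * d ≤ i → cnt I s + d ≤ cnt I (s + 2 * d) := by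
    intro d
    induction d with
    | zero => intro _; simp
    | succ k ih =>
      intro hk
      have h1 := ih (by omega)
      have st : Start I s (s + 2 * (k + 1)) :=
        ⟨by omega, fun j ha hb => h.2.1 j ha (by omega), h.2.2⟩
      have h2 := cnt_lt I (x := s + 2 * k) (y := s + 2 * (k + 1)) (by omega)
        (h.2.1 _ (by omega) hk) ((sel_iff st).2 (by omega))
      omega
  have h1 := h.1
  have h2 := key ((i - s) / 2) (by omega)
  have h3 := cnt_mono I (x := s + 2 * ((i - s) / 2)) (y := i) (by omega)
  omega

/-- If no reduction step applies, the set is packed to the left. -/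
lemma stuck_start (I : Finset ℕ)
    (ha : ∀ s e, 1 ≤ s → Start I s e → (e - s) % 2 = 1 → e + 1 ∉ I → ¬ (0 ∈ I → 3 ≤ s))
    (hb : ∀ s e, 2 ≤ s → Start I s e → (e - s) % 2 = 0 → e + 1 ∉ I → s - 2 ∉ I →
      ¬ (0 ∈ I → 4 ≤ s)) :
    ∀ s, Start I s s → s + 1 ≤ 2 * cnt I s := by
  intro s
  induction s using Nat.strong_induction_on with
  | _ s ih =>
  intro hst
  have hsI : s ∈ I := hst.2.1 s le_rfl le_rfl
  have hsel : Sel I s := (sel_iff hst).2 (by omega)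
  have hpos := cnt_pos I hsI hsel
  have hsel0 : 0 ∈ I → Sel I 0 := fun h =>
    (sel_iff (s := 0) ⟨le_rfl, fun j _ h' => by rw [Nat.le_zero.1 h']; exact h, Or.inl rfl⟩).2
      (by omega)
  by_cases hs2 : s < 2
  · omega
  have hs1I : s - 1 ∉ I := hst.2.2.resolve_left (by omega)
  by_cases hm2 : s - 2 ∈ I
  · obtain ⟨s2, h2⟩ := exists_start I _ hm2
    have st2 : Start I s2 s2 :=
      ⟨le_rfl, fun j hj hj' => h2.2.1 j hj (by have := h2.1; omega), h2.2.2⟩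
    have hle := h2.1
    have i1 := ih s2 (by omega) st2
    have i2 := cnt_chain I h2
    have i3 := cnt_lt I (x := s - 2) (y := s) (by omega) hsI hsel
    by_cases hpar : (s - 2 - s2) % 2 = 0
    · omega
    · by_cases hs20 : s2 = 0
      · subst hs20
        omega
      · have := ha s2 (s - 2) (by omega) h2 (by omega) (by rwa [show s - 2 + 1 = s - 1 by omega])
        push Not at this
        obtain ⟨h0, h3⟩ := this
        have hne : s2 ≠ 1 := by
          rintro rfl
          rcases h2.2.2 with h | h
          · omega
          · exact h h0
        have i4 := cnt_pos I h0 (hsel0 h0)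
        have i5 := cnt_lt I (x := 0) (y := s2) (by omega) (st2.2.1 _ le_rfl le_rfl)
          ((sel_iff st2).2 (by omega))
        omega
  · obtain ⟨e, he1, he2, he3⟩ := exists_end I s hsI
    have ste : Start I s e := ⟨he1, he2, hst.2.2⟩
    have hcase : 0 ∈ I ∧ s < 4 := by
      by_cases hpar : (e - s) % 2 = 0
      · have := hb s e (by omega) ste hpar he3 hm2
        push Not at this
        exact this
      · have := ha s e (by omega) ste (by omega) he3
        push Not at this
        exact ⟨this.1, by omega⟩
    have i4 := cnt_pos I hcase.1 (hsel0 hcase.1)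
    have i5 := cnt_lt I (x := 0) (y := s) (by omega) hsI hsel
    omega

lemma reduce (n : ℕ) : ∀ N, ∀ I : Finset ℕ, ∑ i ∈ I, i = N → I ⊆ Finset.range n →
    ∃ I' : Finset ℕ, I' ⊆ Finset.range (2 * mI I + 1) ∧ tot n I' = tot n I := by
  intro N
  induction N using Nat.strong_induction_on with
  | _ N ih =>
  intro I hN hI
  have hlt : ∀ x ∈ I, x < n := fun x hx => Finset.mem_range.1 (hI hx)
  by_cases ha : ∃ s e, 1 ≤ s ∧ Start I s e ∧ (e - s) % 2 = 1 ∧ e + 1 ∉ I ∧ (0 ∈ I → 3 ≤ s)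
  · obtain ⟨s, e, hs, hst, hpar, he, h0⟩ := ha
    have heI : e ∈ I := hst.2.1 e hst.1 le_rfl
    have hsum := Finset.add_sum_erase I (fun i => i) heI
    obtain ⟨I', h1, h2⟩ := ih (∑ i ∈ I.erase e, i) (by omega)
      (I.erase e) rfl ((Finset.erase_subset _ _).trans hI)
    refine ⟨I', h1.trans ?_, h2.trans ?_⟩
    · have := mI_erase I e he
      intro x hx
      simp only [Finset.mem_range] at hx ⊢
      omega
    · exact drop_last n I s e hs (by omega) hpar (hlt e heI) hst.2.1
        (hst.2.2.resolve_left (by omega)) he h0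
  by_cases hb : ∃ s e, 2 ≤ s ∧ Start I s e ∧ (e - s) % 2 = 0 ∧ e + 1 ∉ I ∧ s - 2 ∉ I ∧
      (0 ∈ I → 4 ≤ s)
  · obtain ⟨s, e, hs, hst, hpar, he, hs2, h0⟩ := hb
    have heI : e ∈ I := hst.2.1 e hst.1 le_rfl
    have hse := hst.1
    have hs1 : s - 1 ∉ I := hst.2.2.resolve_left (by omega)
    have heJ : e ∈ insert (s - 1) I := Finset.mem_insert_of_mem heI
    have hsum := Finset.add_sum_erase (insert (s - 1) I) (fun i => i) heJ
    rw [Finset.sum_insert hs1] at hsum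
    have hen := hlt e heI
    have hJ : ∀ i, s - 1 ≤ i → i ≤ e → i ∈ insert (s - 1) I := by
      intro i h1 h2
      by_cases h3 : i = s - 1
      · rw [h3]; simp
      · exact Finset.mem_insert_of_mem (hst.2.1 i (by omega) h2)
    have hJ1 : s - 1 - 1 ∉ insert (s - 1) I := by
      rw [Finset.mem_insert, not_or]
      exact ⟨by omega, by rwa [show s - 1 - 1 = s - 2 by omega]⟩
    have hJ2 : e + 1 ∉ insert (s - 1) I := by
      rw [Finset.mem_insert, not_or]
      exact ⟨by omega, he⟩
    have hJ0 : 0 ∈ insert (s - 1) I → 3 ≤ s - 1 := by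
      intro h
      rcases Finset.mem_insert.1 h with h | h
      · omega
      · have := h0 h; omega
    have hsub : (insert (s - 1) I).erase e ⊆ Finset.range n := by
      intro x hx
      rcases Finset.mem_insert.1 (Finset.mem_of_mem_erase hx) with h | h
      · rw [Finset.mem_range]; omega
      · exact hI h
    obtain ⟨I', h1, h2⟩ := ih (∑ i ∈ (insert (s - 1) I).erase e, i)
      (by omega) _ rfl hsub
    refine ⟨I', h1.trans ?_, h2.trans ?_⟩
    · have := mI_shift I s e hs hse hst.2.1 hs1 hs2 he
      intro x hx
      simp only [Finset.mem_range] at hx ⊢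
      omega
    · have d1 := drop_last n (insert (s - 1) I) (s - 1) e (by omega) (by omega) (by omega) hen
        hJ hJ1 hJ2 hJ0
      have d2 := drop_first n (insert (s - 1) I) (s - 1) e (by omega) (by omega) (by omega) hen
        hJ hJ1 hJ2 hJ0
      rw [Finset.erase_insert hs1] at d2
      rw [d1, d2]
  · refine ⟨I, ?_, rfl⟩
    intro i hi
    obtain ⟨s, hs⟩ := exists_start I i hi
    have h1 := stuck_start I
      (fun s e a b c d f => ha ⟨s, e, a, b, c, d, f⟩)
      (fun s e a b c d f g => hb ⟨s, e, a, b, c, d, f, g⟩) s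
      ⟨le_rfl, fun j hj hj' => hs.2.1 j hj (by have := hs.1; omega), hs.2.2⟩
    have h2 := cnt_chain I hs
    have h3 := cnt_le I i
    have h4 := hs.1
    rw [Finset.mem_range]
    omega

lemma sval_lt_iff {n : ℕ} (σ : SP n) (i j : Fin n) (hij : i ≠ j) :
    sval σ ((i : ℕ) + 1) < sval σ ((j : ℕ) + 1) ↔
      if (σ.1 i : ℕ) < (σ.1 j : ℕ) then σ.2 j = false else σ.2 i = true := by
  have hne : ((σ.1 i : Fin n) : ℕ) ≠ (σ.1 j : ℕ) := fun h => hij (σ.1.injective (Fin.ext h))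
  simp only [sval_fin]
  generalize ((σ.1 i : Fin n) : ℕ) = a at *
  generalize ((σ.1 j : Fin n) : ℕ) = b at *
  cases σ.2 i <;> cases σ.2 j <;> simp <;> omega

lemma neg_sval_lt_iff {n : ℕ} (σ : SP n) (i j : Fin n) (hij : i ≠ j) :
    -sval σ ((j : ℕ) + 1) < sval σ ((i : ℕ) + 1) ↔
      if (σ.1 i : ℕ) < (σ.1 j : ℕ) then σ.2 j = false else σ.2 i = false := by
  have hne : ((σ.1 i : Fin n) : ℕ) ≠ (σ.1 j : ℕ) := fun h => hij (σ.1.injective (Fin.ext h))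
  simp only [sval_fin]
  generalize ((σ.1 i : Fin n) : ℕ) = a at *
  generalize ((σ.1 j : Fin n) : ℕ) = b at *
  cases σ.2 i <;> cases σ.2 j <;> simp <;> omega

lemma cpair_fin {n : ℕ} (σ : SP n) (i j : Fin n) (hij : i ≠ j) :
    cpair (sval σ) ((i : ℕ) + 1) ((j : ℕ) + 1) =
      if (σ.1 j : ℕ) < (σ.1 i : ℕ) then 1 else if σ.2 j then 2 else 0 := by
  have hne : ((σ.1 i : Fin n) : ℕ) ≠ (σ.1 j : ℕ) := fun h => hij (σ.1.injective (Fin.ext h))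
  unfold cpair
  simp only [sval_fin]
  generalize ((σ.1 i : Fin n) : ℕ) = a at *
  generalize ((σ.1 j : Fin n) : ℕ) = b at *
  cases σ.2 i <;> cases σ.2 j <;>
    simp only [if_true, Bool.false_eq_true, if_false, one_mul, neg_mul] <;> split_ifs <;> omega

/-- Membership in the quotient only depends on signs and relative orders. -/
lemma InQuot_congr {n n' : ℕ} (σ : SP n) (σ' : SP n') (I : Finset ℕ) (k : ℕ) (hk : k ≤ n)
    (hk' : k ≤ n') (hI : I ⊆ Finset.range k) (h0 : 0 ∈ I → 2 ≤ k)
    (hsg : ∀ (i : ℕ) (hi : i < k), σ.2 ⟨i, by omega⟩ = σ'.2 ⟨i, by omega⟩)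
    (hord : ∀ (i : ℕ) (hi : i + 1 < k),
      ((σ.1 ⟨i, by omega⟩ : ℕ) < (σ.1 ⟨i + 1, by omega⟩ : ℕ) ↔
        (σ'.1 ⟨i, by omega⟩ : ℕ) < (σ'.1 ⟨i + 1, by omega⟩ : ℕ))) :
    InQuot σ I ↔ InQuot σ' I := by
  unfold InQuot
  refine forall₂_congr fun i hi => ?_
  have hik : i < k := Finset.mem_range.1 (hI hi)
  unfold dval
  by_cases hi0 : i = 0
  · subst hi0
    have h2 := h0 hi
    simp only [if_true, zero_add, one_ne_zero, if_false]
    have e1 := neg_sval_lt_iff σ ⟨0, by omega⟩ ⟨1, by omega⟩ (by simp)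
    have e2 := neg_sval_lt_iff σ' ⟨0, by omega⟩ ⟨1, by omega⟩ (by simp)
    simp only [zero_add] at e1 e2
    have e3 := hord 0 (by omega)
    simp only [zero_add] at e3
    rw [show (2 : ℕ) = 1 + 1 from rfl, e1, e2, hsg 0 (by omega), hsg 1 (by omega)]
    simp only [e3]
  · obtain ⟨m, rfl⟩ : ∃ m, i = m + 1 := ⟨i - 1, by omega⟩
    simp only [Nat.add_eq_zero_iff, one_ne_zero, and_false, if_false]
    have e1 := sval_lt_iff σ ⟨m, by omega⟩ ⟨m + 1, by omega⟩ (by simp)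
    have e2 := sval_lt_iff σ' ⟨m, by omega⟩ ⟨m + 1, by omega⟩ (by simp)
    simp only at e1 e2
    rw [e1, e2, hsg m (by omega), hsg (m + 1) (by omega)]
    simp only [hord m (by omega)]

/-- Swap the absolute values `a` and `b`. -/
def valSwap {n : ℕ} (a b : Fin n) (σ : SP n) : SP n := (Equiv.swap a b * σ.1, σ.2)

lemma valSwap_valSwap {n : ℕ} (a b : Fin n) (σ : SP n) : valSwap a b (valSwap a b σ) = σ := by
  unfold valSwap
  ext i
  · simp
  · simp

/-- The hypothesis under which a swap of absolute values is harmless. -/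
def Good {n : ℕ} (a b : Fin n) (k : ℕ) (σ : SP n) : Prop :=
  a < b ∧ (σ.1.symm a : ℕ) % 2 = (σ.1.symm b : ℕ) % 2 ∧
    ∀ j : Fin n, (j : ℕ) % 2 ≠ (σ.1.symm a : ℕ) % 2 → (σ.1 j < a ∨ b < σ.1 j) ∨ (j : ℕ) = k

lemma valSwap_order {n : ℕ} (a b : Fin n) (k : ℕ) (σ : SP n) (hg : Good a b k σ)
    (i j : Fin n) (hi : (i : ℕ) ≠ k) (hj : (j : ℕ) ≠ k) (hij : (i : ℕ) % 2 ≠ (j : ℕ) % 2) :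
    (σ.1 i : ℕ) < (σ.1 j : ℕ) ↔ ((valSwap a b σ).1 i : ℕ) < ((valSwap a b σ).1 j : ℕ) := by
  obtain ⟨hab, hp, H⟩ := hg
  have hab' : (a : ℕ) < b := hab
  have hs : ∀ x : Fin n, (x : ℕ) % 2 ≠ (σ.1.symm a : ℕ) % 2 →
      Equiv.swap a b (σ.1 x) = σ.1 x := by
    intro x hx
    refine Equiv.swap_apply_of_ne_of_ne ?_ ?_
    · rintro h; apply hx; rw [← h]; simp
    · rintro h; apply hx; rw [hp, ← h]; simp
  have hs2 : ∀ x : Fin n, (σ.1 x = a ∧ Equiv.swap a b (σ.1 x) = b) ∨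
      (σ.1 x = b ∧ Equiv.swap a b (σ.1 x) = a) ∨ Equiv.swap a b (σ.1 x) = σ.1 x := by
    intro x
    by_cases h1 : σ.1 x = a
    · left; simp [h1]
    · by_cases h2 : σ.1 x = b
      · right; left; simp [h2]
      · right; right; exact Equiv.swap_apply_of_ne_of_ne h1 h2
  unfold valSwap
  simp only [Equiv.Perm.coe_mul, Function.comp_apply]
  by_cases hip : (i : ℕ) % 2 = (σ.1.symm a : ℕ) % 2
  · have hjp : (j : ℕ) % 2 ≠ (σ.1.symm a : ℕ) % 2 := by omega
    rw [hs j hjp]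
    have := (H j hjp).resolve_right hj
    simp only [Fin.lt_def] at this
    rcases hs2 i with ⟨h1, h2⟩ | ⟨h1, h2⟩ | h2
    · rw [h2, h1]; omega
    · rw [h2, h1]; omega
    · rw [h2]
  · rw [hs i hip]
    have := (H i hip).resolve_right hi
    simp only [Fin.lt_def] at this
    rcases hs2 j with ⟨h1, h2⟩ | ⟨h1, h2⟩ | h2
    · rw [h2, h1]; omega
    · rw [h2, h1]; omega
    · rw [h2]

lemma valSwap_InQuot {n : ℕ} (a b : Fin n) (k : ℕ) (σ : SP n) (hg : Good a b k σ)
    (I : Finset ℕ) (hk : k ≤ n) (hI : I ⊆ Finset.range k) (h0 : 0 ∈ I → 2 ≤ k)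
    (hQ : InQuot σ I) : InQuot (valSwap a b σ) I := by
  refine (InQuot_congr σ (valSwap a b σ) I k hk hk hI h0 (fun i hi => rfl) ?_).1 hQ
  intro i hi
  exact valSwap_order a b k σ hg _ _ (by simp; omega) (by simp; omega) (by simp; omega)

lemma valSwap_wt {n : ℕ} (a b : Fin n) (k : ℕ) (σ : SP n) (hg : Good a b k σ)
    (hk : n ≤ k + 1) : wt (valSwap a b σ) = - wt σ := by
  have hg' := hg
  obtain ⟨hab, hp, H⟩ := hg
  have hne : a ≠ b := hab.ne
  have hab' : (a : ℕ) < b := hab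
  refine wt_neg _ _ ?_ (by simp [valSwap, Equiv.Perm.sign_swap hne])
  set q := σ.1.symm a with hq
  set r := σ.1.symm b with hr
  have hσq : σ.1 q = a := by simp [hq]
  have hσr : σ.1 r = b := by simp [hr]
  have hqr : q ≠ r := fun h => hne (by rw [← hσq, ← hσr, h])
  have hqr' : (q : ℕ) ≠ (r : ℕ) := fun h => hqr (Fin.ext h)
  refine LD_congr σ _ ((q : ℕ) + 1) ((r : ℕ) + 1) (by omega) (by omega) (by omega) (by omega)
    ?_ ?_
  · intro i h1 h2
    by_cases h : 1 ≤ i ∧ i ≤ n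
    · obtain ⟨x, rfl⟩ : ∃ k : Fin n, i = (k : ℕ) + 1 := ⟨⟨i - 1, by omega⟩, by simp; omega⟩
      rw [sval_fin, sval_fin]
      have e1 : σ.1 x ≠ a := fun h => h1 (by rw [hq, ← h]; simp)
      have e2 : σ.1 x ≠ b := fun h => h2 (by rw [hr, ← h]; simp)
      have e3 : (valSwap a b σ).1 x = σ.1 x := by
        simp [valSwap, Equiv.swap_apply_of_ne_of_ne e1 e2]
      rw [e3]
      rfl
    · rw [sval_out _ _ h, sval_out _ _ h]
  · intro j' h1 h2 h3
    obtain ⟨j, rfl⟩ : ∃ k : Fin n, j' = (k : ℕ) + 1 := ⟨⟨j' - 1, by omega⟩, by simp; omega⟩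
    have hjq : j ≠ q := by rintro rfl; exact h3 rfl
    have hjr : j ≠ r := by rintro rfl; apply h3; omega
    have hjq' : (j : ℕ) ≠ (q : ℕ) := fun h => hjq (Fin.ext h)
    have hjr' : (j : ℕ) ≠ (r : ℕ) := fun h => hjr (Fin.ext h)
    unfold spair
    rw [cpair_fin _ _ _ hjq, cpair_fin _ _ _ hjq.symm, cpair_fin _ _ _ hjr,
      cpair_fin _ _ _ hjr.symm, cpair_fin _ _ _ hjq, cpair_fin _ _ _ hjq.symm,
      cpair_fin _ _ _ hjr, cpair_fin _ _ _ hjr.symm]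
    have e1 : σ.1 j ≠ a := fun h => hjq (by rw [hq, ← h]; simp)
    have e2 : σ.1 j ≠ b := fun h => hjr (by rw [hr, ← h]; simp)
    have hj := H j (by omega)
    have v1 : (valSwap a b σ).1 q = b := by simp [valSwap, hσq]
    have v2 : (valSwap a b σ).1 r = a := by simp [valSwap, hσr]
    have v3 : (valSwap a b σ).1 j = σ.1 j := by
      simp [valSwap, Equiv.swap_apply_of_ne_of_ne e1 e2]
    have v4 : (valSwap a b σ).2 = σ.2 := rfl
    rw [v1, v2, v3, v4, hσq, hσr]
    rcases hj with hj | hj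
    · simp only [Fin.lt_def] at hj
      have g1 : (a : ℕ) < (σ.1 j : ℕ) ↔ (b : ℕ) < (σ.1 j : ℕ) := by omega
      have g2 : (σ.1 j : ℕ) < (a : ℕ) ↔ (σ.1 j : ℕ) < (b : ℕ) := by omega
      simp only [g1, g2]
    · have g1 : (q : ℕ) + 1 < (j : ℕ) + 1 := by omega
      have g2 : (r : ℕ) + 1 < (j : ℕ) + 1 := by omega
      simp only [g1, g2, if_true]
      exact add_comm _ _

/-- Chessboard elements of type `ε`. -/
def Ch {n : ℕ} (ε : ℕ) (σ : SP n) : Prop := ∀ i : Fin n, ((σ.1 i : ℕ) + (i : ℕ)) % 2 = ε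

open Classical in
/-- Weighted sum over the chessboard elements. -/
noncomputable def E (n : ℕ) (I : Finset ℕ) (ε : ℕ) : Polynomial ℤ :=
  ∑ σ ∈ Finset.univ.filter (fun σ : SP n => InQuot σ I ∧ Ch ε σ), wt σ

/-- Position parities of the values. -/
def ppar {n : ℕ} (σ : SP n) : Fin n → Bool := fun x => decide ((σ.1.symm x : ℕ) % 2 = 0)

/-- The alternating patterns. -/
def alt (n ε : ℕ) : Fin n → Bool := fun x => decide (((x : ℕ) + ε) % 2 = 0)

lemma ppar_alt {n : ℕ} (σ : SP n) (ε : ℕ) (hε : ε < 2) : ppar σ = alt n ε ↔ Ch ε σ := by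
  unfold ppar alt Ch
  rw [funext_iff]
  constructor
  · intro h i
    have := h (σ.1 i)
    simp only [Equiv.symm_apply_apply, decide_eq_decide] at this
    omega
  · intro h x
    have := h (σ.1.symm x)
    simp only [Equiv.apply_symm_apply] at this
    simp only [decide_eq_decide]
    omega

lemma not_alt {n : ℕ} (hn : 1 ≤ n) (p : Fin n → Bool) (h0 : p ≠ alt n 0) (h1 : p ≠ alt n 1) :
    ∃ (a : ℕ) (ha : a + 1 < n), p ⟨a, by omega⟩ = p ⟨a + 1, ha⟩ := by
  by_contra hcon
  push Not at hcon
  have key : ∀ (x : ℕ) (hx : x < n),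
      p ⟨x, hx⟩ = if x % 2 = 0 then p ⟨0, by omega⟩ else !p ⟨0, by omega⟩ := by
    intro x
    induction x with
    | zero => intro hx; simp
    | succ k ih =>
      intro hx
      have h2 := hcon k hx
      rw [ih (by omega)] at h2
      rcases Nat.mod_two_eq_zero_or_one k with hk | hk
      · have : (k + 1) % 2 = 1 := by omega
        simp only [hk, this, if_true, one_ne_zero, if_false] at h2 ⊢
        cases h3 : p ⟨k + 1, hx⟩ <;> cases h4 : p ⟨0, by omega⟩ <;> simp_all
      · have : (k + 1) % 2 = 0 := by omega
        simp only [hk, this, if_true, one_ne_zero, if_false] at h2 ⊢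
        cases h3 : p ⟨k + 1, hx⟩ <;> cases h4 : p ⟨0, by omega⟩ <;> simp_all
  cases h4 : p ⟨0, by omega⟩
  · apply h1
    funext x
    rw [key x x.2, h4]
    unfold alt
    rcases Nat.mod_two_eq_zero_or_one (x : ℕ) with hk | hk
    · have : ((x : ℕ) + 1) % 2 = 1 := by omega
      simp [hk, this]
    · have : ((x : ℕ) + 1) % 2 = 0 := by omega
      simp [hk, this]
  · apply h0
    funext x
    rw [key x x.2, h4]
    unfold alt
    rcases Nat.mod_two_eq_zero_or_one (x : ℕ) with hk | hk <;> simp [hk]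

lemma tot_eq (n : ℕ) (hn : 1 ≤ n) (I : Finset ℕ) (hI : I ⊆ Finset.range n)
    (h0 : 0 ∈ I → 2 ≤ n) : tot n I = E n I 0 + E n I 1 := by
  classical
  unfold tot E
  rw [← Finset.sum_fiberwise (Finset.univ.filter (fun σ : SP n => InQuot σ I)) ppar wt]
  rw [Fintype.sum_eq_add (alt n 0) (alt n 1)]
  · congr 1
    · refine Finset.sum_congr ?_ fun _ _ => rfl
      ext σ
      simp only [Finset.mem_filter, Finset.mem_univ, true_and, ppar_alt σ 0 (by omega)]
    · refine Finset.sum_congr ?_ fun _ _ => rfl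
      ext σ
      simp only [Finset.mem_filter, Finset.mem_univ, true_and, ppar_alt σ 1 (by omega)]
  · intro h
    have := congrFun h ⟨0, by omega⟩
    simp [alt] at this
  · rintro p ⟨h1, h2⟩
    obtain ⟨a, ha, hpa⟩ := not_alt hn p h1 h2
    have hgood : ∀ σ : SP n, ppar σ = p →
        Good (⟨a, by omega⟩ : Fin n) (⟨a + 1, ha⟩ : Fin n) n σ := by
      intro σ hσ
      refine ⟨by simp, ?_, ?_⟩
      · rw [← hσ] at hpa
        unfold ppar at hpa
        simp only [decide_eq_decide] at hpa
        omega
      · intro j hj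
        left
        simp only [Fin.lt_def]
        by_contra hcon
        have h3 : σ.1 j = ⟨a, by omega⟩ ∨ σ.1 j = ⟨a + 1, ha⟩ := by
          simp only [Fin.ext_iff]; omega
        rw [← hσ] at hpa
        unfold ppar at hpa
        simp only [decide_eq_decide] at hpa
        rcases h3 with h3 | h3
        · apply hj; rw [← h3]; simp
        · have h4 : σ.1.symm ⟨a + 1, ha⟩ = j := by rw [← h3]; simp
          rw [h4] at hpa
          omega
    refine sum_zero_of_swap _ (valSwap ⟨a, by omega⟩ ⟨a + 1, ha⟩) ?_
      (fun σ _ => valSwap_valSwap _ _ σ) ?_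
    · intro σ hσ
      simp only [Finset.mem_filter, Finset.mem_univ, true_and] at hσ ⊢
      refine ⟨valSwap_InQuot _ _ n σ (hgood σ hσ.2) I le_rfl hI h0 hσ.1, ?_⟩
      rw [← hσ.2]
      funext x
      have hp := hpa
      rw [← hσ.2] at hp
      have e : (valSwap (⟨a, by omega⟩ : Fin n) ⟨a + 1, ha⟩ σ).1.symm x =
          σ.1.symm (Equiv.swap (⟨a, by omega⟩ : Fin n) ⟨a + 1, ha⟩ x) := by
        rw [Equiv.symm_apply_eq]
        simp [valSwap]
      unfold ppar at hp ⊢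
      rw [e]
      by_cases hx1 : x = ⟨a, by omega⟩
      · rw [hx1, Equiv.swap_apply_left]; exact hp.symm
      · by_cases hx2 : x = ⟨a + 1, ha⟩
        · rw [hx2, Equiv.swap_apply_right]; exact hp
        · rw [Equiv.swap_apply_of_ne_of_ne hx1 hx2]
    · intro σ hσ
      simp only [Finset.mem_filter, Finset.mem_univ, true_and] at hσ
      exact valSwap_wt _ _ n σ (hgood σ hσ.2) (by omega)

/-- The underlying map of an extension. -/
def extFun {n : ℕ} (u : Fin (n + 1)) (t : Equiv.Perm (Fin n)) : Fin (n + 1) → Fin (n + 1) :=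
  Fin.lastCases u (fun i => u.succAbove (t i))

lemma extFun_inj {n : ℕ} (u : Fin (n + 1)) (t : Equiv.Perm (Fin n)) :
    Function.Injective (extFun u t) := by
  intro i j
  induction i using Fin.lastCases with
  | last =>
    induction j using Fin.lastCases with
    | last => intro _; rfl
    | cast j =>
      intro h
      simp only [extFun, Fin.lastCases_last, Fin.lastCases_castSucc] at h
      exact absurd h.symm (Fin.succAbove_ne _ _)
  | cast i =>
    induction j using Fin.lastCases with
    | last =>
      intro h
      simp only [extFun, Fin.lastCases_last, Fin.lastCases_castSucc] at h
      exact absurd h (Fin.succAbove_ne _ _)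
    | cast j =>
      intro h
      simp only [extFun, Fin.lastCases_castSucc] at h
      rw [t.injective (Fin.succAbove_right_injective h)]

/-- Append a last entry of absolute value index `u` and sign `b`. -/
noncomputable def extP {n : ℕ} (u : Fin (n + 1)) (b : Bool) (τ : SP n) : SP (n + 1) :=
  (Equiv.ofBijective (extFun u τ.1) (Finite.injective_iff_bijective.1 (extFun_inj u τ.1)),
    Fin.snoc (α := fun _ => Bool) τ.2 b)

lemma extP_last {n : ℕ} (u : Fin (n + 1)) (b : Bool) (τ : SP n) :
    (extP u b τ).1 (Fin.last n) = u := by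
  simp [extP, extFun]

lemma extP_cast {n : ℕ} (u : Fin (n + 1)) (b : Bool) (τ : SP n) (i : Fin n) :
    (extP u b τ).1 i.castSucc = u.succAbove (τ.1 i) := by
  simp [extP, extFun]

lemma extP_sg_last {n : ℕ} (u : Fin (n + 1)) (b : Bool) (τ : SP n) :
    (extP u b τ).2 (Fin.last n) = b := by
  simp [extP]

lemma extP_sg_cast {n : ℕ} (u : Fin (n + 1)) (b : Bool) (τ : SP n) (i : Fin n) :
    (extP u b τ).2 i.castSucc = τ.2 i := by
  simp [extP]

lemma extP_bij (n : ℕ) : Function.Bijective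
    (fun p : Fin (n + 1) × Bool × SP n => extP p.1 p.2.1 p.2.2) := by
  rw [Fintype.bijective_iff_injective_and_card]
  constructor
  · rintro ⟨u, b, τ⟩ ⟨u', b', τ'⟩ h
    simp only at h
    have h1 : u = u' := by rw [← extP_last u b τ, h, extP_last]
    subst h1
    have h2 : b = b' := by rw [← extP_sg_last u b τ, h, extP_sg_last]
    subst h2
    have h3 : τ = τ' := by
      refine Prod.ext (Equiv.ext fun i => ?_) (funext fun i => ?_)
      · have := extP_cast u b τ i
        rw [h, extP_cast] at this
        exact (Fin.succAbove_right_injective this).symm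
      · rw [← extP_sg_cast u b τ i, h, extP_sg_cast]
    rw [h3]
  · simp only [Fintype.card_prod, Fintype.card_fin, Fintype.card_bool, Fintype.card_perm,
      Fintype.card_fun, Nat.factorial_succ, pow_succ]
    ring

lemma succAbove_lt_iff' {n : ℕ} (u : Fin (n + 1)) (a b : Fin n) :
    (u.succAbove a : ℕ) < (u.succAbove b : ℕ) ↔ (a : ℕ) < (b : ℕ) := by
  rw [← Fin.lt_def, ← Fin.lt_def]
  exact (Fin.strictMono_succAbove u).lt_iff_lt

lemma extP_InQuot {n : ℕ} (u : Fin (n + 1)) (b : Bool) (τ : SP n) (I : Finset ℕ)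
    (hI : I ⊆ Finset.range n) (h0 : 0 ∈ I → 2 ≤ n) :
    InQuot (extP u b τ) I ↔ InQuot τ I := by
  refine InQuot_congr _ _ I n (by omega) le_rfl hI h0 ?_ ?_
  · intro i hi
    exact extP_sg_cast u b τ ⟨i, hi⟩
  · intro i hi
    have e1 := extP_cast u b τ ⟨i, by omega⟩
    have e2 := extP_cast u b τ ⟨i + 1, by omega⟩
    rw [show (⟨i, by omega⟩ : Fin (n + 1)) = (⟨i, by omega⟩ : Fin n).castSucc from rfl,
      show (⟨i + 1, by omega⟩ : Fin (n + 1)) = (⟨i + 1, by omega⟩ : Fin n).castSucc from rfl,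
      e1, e2, succAbove_lt_iff']

lemma pairs_fin {n i j : ℕ} (h : (i, j) ∈ pairs n) : ∃ a b : Fin n, i = (a : ℕ) + 1 ∧
    j = (b : ℕ) + 1 ∧ a ≠ b := by
  unfold pairs at h
  simp only [Finset.mem_filter, Finset.mem_product, Finset.mem_Icc] at h
  refine ⟨⟨i - 1, by omega⟩, ⟨j - 1, by omega⟩, by simp; omega, by simp; omega, ?_⟩
  intro h2
  simp only [Fin.ext_iff] at h2
  omega

lemma extP_cpair {n : ℕ} (u : Fin (n + 1)) (b : Bool) (τ : SP n) {i j : ℕ}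
    (h : (i, j) ∈ pairs n) :
    cpair (sval (extP u b τ)) i j = cpair (sval τ) i j := by
  obtain ⟨x, y, rfl, rfl, hxy⟩ := pairs_fin h
  rw [cpair_fin _ _ _ hxy]
  have := cpair_fin (extP u b τ) x.castSucc y.castSucc (by simpa using hxy)
  simp only [Fin.val_castSucc] at this
  rw [this, extP_cast, extP_cast, extP_sg_cast]
  simp only [succAbove_lt_iff']

lemma extP_cpair_last {n : ℕ} (u : Fin (n + 1)) (b : Bool) (τ : SP n) (i : Fin n) :
    cpair (sval (extP u b τ)) ((i : ℕ) + 1) (n + 1) =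
      if (u : ℕ) < (u.succAbove (τ.1 i) : ℕ) then 1 else if b then 2 else 0 := by
  have := cpair_fin (extP u b τ) i.castSucc (Fin.last n) (Fin.castSucc_lt_last i).ne
  simp only [Fin.val_castSucc, Fin.val_last] at this
  rw [this, extP_cast, extP_last, extP_sg_last]

lemma cnt_par (n : ℕ) :
    (∑ i ∈ Finset.Icc 1 n, if i % 2 ≠ (n + 1) % 2 then 1 else 0) = (n + 1) / 2 := by
  have key : ∀ m, (∑ i ∈ Finset.Icc 1 m, if i % 2 ≠ 0 then 1 else 0) = (m + 1) / 2 ∧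
      (∑ i ∈ Finset.Icc 1 m, if i % 2 ≠ 1 then 1 else 0) = m / 2 := by
    intro m
    induction m with
    | zero => simp
    | succ k ih =>
      rw [Finset.sum_Icc_succ_top (by omega), Finset.sum_Icc_succ_top (by omega), ih.1, ih.2]
      constructor <;> split_ifs <;> omega
  rcases Nat.mod_two_eq_zero_or_one (n + 1) with h | h
  · rw [h, (key n).1]
  · rw [h, (key n).2]; omega

/-- Lengths when the last column has constant contribution `c`. -/
lemma extP_len {n : ℕ} (u : Fin (n + 1)) (b : Bool) (τ : SP n) (c : ℕ)
    (hc : ∀ i : Fin n, (if (u : ℕ) < (u.succAbove (τ.1 i) : ℕ) then 1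
      else if b then 2 else 0) = c) :
    wt (extP u b τ) = (-1) ^ (n * c) * X ^ ((n + 1) / 2 * c) * wt τ := by
  have hl : ∀ i ∈ Finset.Icc 1 n, cpair (sval (extP u b τ)) i (n + 1) = c := by
    intro i hi
    simp only [Finset.mem_Icc] at hi
    have := extP_cpair_last u b τ ⟨i - 1, by omega⟩
    rw [hc] at this
    simp only [Nat.sub_add_cancel hi.1] at this
    exact this
  have h1 : ellD (extP u b τ) = ellD τ + n * c := by
    rw [ellD_eq, ellD_eq, sum_pairs_succ n (fun i j => cpair (sval (extP u b τ)) i j),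
      Finset.sum_congr rfl hl]
    congr 1
    · exact Finset.sum_congr rfl fun p hp => extP_cpair u b τ hp
    · simp
  have h2 : LD (extP u b τ) = LD τ + (n + 1) / 2 * c := by
    rw [LD_eq, LD_eq, sum_pairs_succ n
      (fun i j => if i % 2 ≠ j % 2 then cpair (sval (extP u b τ)) i j else 0)]
    congr 1
    · refine Finset.sum_congr rfl fun p hp => ?_
      rw [extP_cpair u b τ hp]
    · rw [← cnt_par n, Finset.sum_mul]
      refine Finset.sum_congr rfl fun i hi => ?_
      rw [hl i hi]
      split_ifs <;> simp
  unfold wt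
  rw [h1, h2, pow_add, pow_add]
  ring

lemma wt_ext_last {n : ℕ} (b : Bool) (τ : SP n) :
    wt (extP (Fin.last n) b τ) = (if b then X ^ (2 * ((n + 1) / 2)) else 1) * wt τ := by
  rw [extP_len (Fin.last n) b τ (if b then 2 else 0) (fun i => by
    rw [if_neg]
    simp only [Fin.succAbove_last, Fin.val_last, Fin.val_castSucc]
    omega)]
  cases b
  · simp
  · simp only [if_true]
    rw [pow_mul', mul_comm ((n + 1) / 2)]
    simp

lemma wt_ext_zero {n : ℕ} (b : Bool) (τ : SP n) :
    wt (extP 0 b τ) = (-1) ^ n * X ^ ((n + 1) / 2) * wt τ := by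
  rw [extP_len 0 b τ 1 (fun i => by simp)]
  simp

lemma Ch_ext_last {n : ℕ} (b : Bool) (τ : SP n) (ε : ℕ) :
    Ch ε (extP (Fin.last n) b τ) ↔ Ch ε τ ∧ ε = 0 := by
  unfold Ch
  rw [Fin.forall_fin_succ']
  simp only [extP_cast, extP_last, Fin.succAbove_last, Fin.val_castSucc, Fin.val_last]
  refine and_congr_right fun _ => ?_
  omega

lemma Ch_ext_zero {n : ℕ} (b : Bool) (τ : SP n) (ε : ℕ) (hε : ε < 2) :
    Ch ε (extP 0 b τ) ↔ Ch (1 - ε) τ ∧ n % 2 = ε := by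
  unfold Ch
  rw [Fin.forall_fin_succ']
  simp only [extP_cast, extP_last, Fin.succAbove_zero, Fin.val_castSucc, Fin.val_last,
    Fin.val_succ, Fin.val_zero, zero_add]
  refine and_congr_left fun _ => forall_congr' fun i => ?_
  omega

open Classical in
/-- The part of the chessboard sum with prescribed last entry. -/
lemma fiber_ext {n : ℕ} (I : Finset ℕ) (hI : I ⊆ Finset.range n) (h0 : 0 ∈ I → 2 ≤ n)
    (ε : ℕ) (u : Fin (n + 1)) :
    ∑ σ ∈ (Finset.univ.filter (fun σ : SP (n + 1) => InQuot σ I ∧ Ch ε σ)).filter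
      (fun σ => σ.1 (Fin.last n) = u), wt σ =
    ∑ b : Bool, ∑ τ ∈ Finset.univ.filter (fun τ : SP n => InQuot τ I ∧ Ch ε (extP u b τ)),
      wt (extP u b τ) := by
  have e : ∀ b : Bool, ∑ τ ∈ Finset.univ.filter
      (fun τ : SP n => InQuot τ I ∧ Ch ε (extP u b τ)), wt (extP u b τ) =
      ∑ τ : SP n, if InQuot τ I ∧ Ch ε (extP u b τ) then wt (extP u b τ) else 0 := fun b => by
    rw [Finset.sum_filter]
  simp only [e]
  rw [Finset.filter_filter, Finset.sum_filter,
    ← (extP_bij n).sum_comp (fun σ => if (InQuot σ I ∧ Ch ε σ) ∧ σ.1 (Fin.last n) = u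
      then wt σ else 0), Fintype.sum_prod_type]
  rw [Fintype.sum_eq_single u]
  · rw [Fintype.sum_prod_type]
    refine Finset.sum_congr rfl fun b _ => Finset.sum_congr rfl fun τ _ => ?_
    simp only [extP_last, and_true, extP_InQuot u b τ I hI h0]
  · intro v hv
    refine Finset.sum_eq_zero fun p _ => if_neg ?_
    rintro ⟨_, h⟩
    rw [extP_last] at h
    exact hv h

open Classical in
lemma fiber_last {n : ℕ} (I : Finset ℕ) (hI : I ⊆ Finset.range n) (h0 : 0 ∈ I → 2 ≤ n)
    (ε : ℕ) :
    ∑ σ ∈ (Finset.univ.filter (fun σ : SP (n + 1) => InQuot σ I ∧ Ch ε σ)).filter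
      (fun σ => σ.1 (Fin.last n) = Fin.last n), wt σ =
    if ε = 0 then (1 + X ^ (2 * ((n + 1) / 2))) * E n I 0 else 0 := by
  rw [fiber_ext I hI h0]
  simp only [Ch_ext_last, wt_ext_last, ← Finset.mul_sum]
  split_ifs with h
  · subst h
    simp only [and_true, Fintype.sum_bool, if_true, Bool.false_eq_true, if_false]
    unfold E
    ring
  · simp [h]

open Classical in
lemma fiber_zero {n : ℕ} (I : Finset ℕ) (hI : I ⊆ Finset.range n) (h0 : 0 ∈ I → 2 ≤ n)
    (ε : ℕ) (hε : ε < 2) :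
    ∑ σ ∈ (Finset.univ.filter (fun σ : SP (n + 1) => InQuot σ I ∧ Ch ε σ)).filter
      (fun σ => σ.1 (Fin.last n) = 0), wt σ =
    if n % 2 = ε then (-1) ^ n * 2 * X ^ ((n + 1) / 2) * E n I (1 - ε) else 0 := by
  rw [fiber_ext I hI h0]
  simp only [Ch_ext_zero _ _ ε hε, wt_ext_zero, ← Finset.mul_sum]
  split_ifs with h
  · simp only [h, and_true, Fintype.sum_bool]
    unfold E
    ring
  · simp [h]

open Classical in
lemma fiber_mid {n : ℕ} (I : Finset ℕ) (hI : I ⊆ Finset.range n) (h0 : 0 ∈ I → 2 ≤ n)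
    (ε : ℕ) (u : Fin (n + 1)) (hu0 : u ≠ 0) (hu1 : u ≠ Fin.last n) :
    ∑ σ ∈ (Finset.univ.filter (fun σ : SP (n + 1) => InQuot σ I ∧ Ch ε σ)).filter
      (fun σ => σ.1 (Fin.last n) = u), wt σ = 0 := by
  have hu0' : (u : ℕ) ≠ 0 := fun h => hu0 (Fin.ext h)
  have hu1' : (u : ℕ) ≠ n := fun h => hu1 (Fin.ext h)
  have hult := u.2
  set a : Fin (n + 1) := ⟨u - 1, by omega⟩ with ha
  set b : Fin (n + 1) := ⟨u + 1, by omega⟩ with hb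
  have hav : (a : ℕ) = u - 1 := rfl
  have hbv : (b : ℕ) = u + 1 := rfl
  have hgood : ∀ σ : SP (n + 1), Ch ε σ → σ.1 (Fin.last n) = u → Good a b n σ := by
    intro σ hσ hlast
    have c1 := hσ (σ.1.symm a)
    have c2 := hσ (σ.1.symm b)
    rw [Equiv.apply_symm_apply] at c1 c2
    refine ⟨by rw [Fin.lt_def]; omega, by omega, ?_⟩
    intro j hj
    by_cases hju : σ.1 j = u
    · right
      have : j = Fin.last n := σ.1.injective (by rw [hju, hlast])
      rw [this]; rfl
    · left
      have c3 := hσ j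
      have c4 : (σ.1 j : ℕ) ≠ u := fun h => hju (Fin.ext h)
      rw [Fin.lt_def, Fin.lt_def]
      omega
  refine sum_zero_of_swap _ (valSwap a b) ?_ (fun σ _ => valSwap_valSwap _ _ σ) ?_
  · intro σ hσ
    simp only [Finset.mem_filter, Finset.mem_univ, true_and] at hσ ⊢
    obtain ⟨⟨h1, h2⟩, h3⟩ := hσ
    refine ⟨⟨valSwap_InQuot _ _ n σ (hgood σ h2 h3) I (by omega) hI h0 h1, ?_⟩, ?_⟩
    · intro i
      have := h2 i
      show ((Equiv.swap a b (σ.1 i) : ℕ) + (i : ℕ)) % 2 = ε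
      by_cases e1 : σ.1 i = a
      · rw [e1] at this
        rw [e1, Equiv.swap_apply_left]; omega
      · by_cases e2 : σ.1 i = b
        · rw [e2] at this
          rw [e2, Equiv.swap_apply_right]; omega
        · rw [Equiv.swap_apply_of_ne_of_ne e1 e2]; exact this
    · show Equiv.swap a b (σ.1 (Fin.last n)) = u
      rw [h3]
      refine Equiv.swap_apply_of_ne_of_ne ?_ ?_
      · intro h; have := congrArg Fin.val h; omega
      · intro h; have := congrArg Fin.val h; omega
  · intro σ hσ
    simp only [Finset.mem_filter, Finset.mem_univ, true_and] at hσ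
    exact valSwap_wt _ _ n σ (hgood σ hσ.1.2 hσ.2) (by omega)

lemma E_succ (n : ℕ) (hn : 1 ≤ n) (I : Finset ℕ) (hI : I ⊆ Finset.range n)
    (h0 : 0 ∈ I → 2 ≤ n) (ε : ℕ) (hε : ε < 2) :
    E (n + 1) I ε = (if ε = 0 then (1 + X ^ (2 * ((n + 1) / 2))) * E n I 0 else 0) +
      (if n % 2 = ε then (-1) ^ n * 2 * X ^ ((n + 1) / 2) * E n I (1 - ε) else 0) := by
  classical
  rw [← fiber_last I hI h0 ε, ← fiber_zero I hI h0 ε hε]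
  unfold E
  rw [← Finset.sum_fiberwise _ (fun σ : SP (n + 1) => σ.1 (Fin.last n)) wt]
  rw [Fintype.sum_eq_add (Fin.last n) 0]
  · intro h
    have := congrArg Fin.val h
    simp at this
    omega
  · rintro u ⟨h1, h2⟩
    convert fiber_mid I hI h0 ε u h2 h1

lemma E_one_odd (k : ℕ) (hk : k % 2 = 1) (I : Finset ℕ) : E k I 1 = 0 := by
  classical
  unfold E
  refine Finset.sum_eq_zero fun σ hσ => ?_
  exfalso
  simp only [Finset.mem_filter, Finset.mem_univ, true_and] at hσ
  have hs : ∑ i : Fin k, ((σ.1 i : ℕ) + (i : ℕ)) = 2 * ∑ i : Fin k, (i : ℕ) := by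
    rw [Finset.sum_add_distrib, Equiv.sum_comp σ.1 (fun i : Fin k => (i : ℕ))]
    ring
  have h2 : (∑ i : Fin k, ((σ.1 i : ℕ) + (i : ℕ))) % 2 = k % 2 := by
    rw [Finset.sum_nat_mod, Finset.sum_congr rfl (fun i _ => hσ.2 i)]
    simp
  omega

lemma E_even (k : ℕ) (hk : k % 2 = 1) (I : Finset ℕ) (hI : I ⊆ Finset.range k)
    (h0 : 0 ∈ I → 2 ≤ k) :
    E (k + 1) I 0 = (1 + X ^ (2 * ((k + 1) / 2))) * E k I 0 ∧
      E (k + 1) I 1 = - 2 * X ^ ((k + 1) / 2) * E k I 0 := by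
  constructor
  · rw [E_succ k (by omega) I hI h0 0 (by omega), if_pos rfl, if_neg (by omega), add_zero]
  · rw [E_succ k (by omega) I hI h0 1 (by omega), if_neg (by omega), if_pos hk, zero_add,
      Odd.neg_one_pow (Nat.odd_iff.2 hk)]
    ring

lemma E_odd (k : ℕ) (hk : k % 2 = 1) (I : Finset ℕ) (hI : I ⊆ Finset.range k)
    (h0 : 0 ∈ I → 2 ≤ k) :
    E (k + 2) I 0 = ((1 - X ^ ((k + 1) / 2)) * (1 + X ^ ((k + 1) / 2))) ^ 2 * E k I 0 := by
  obtain ⟨e1, e2⟩ := E_even k hk I hI h0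
  rw [show k + 2 = (k + 1) + 1 from rfl, E_succ (k + 1) (by omega) I
    (hI.trans (Finset.range_subset_range.2 (by omega))) (fun h => by have := h0 h; omega) 0
    (by omega), if_pos rfl, if_pos (by omega), Nat.sub_zero, e1, e2,
    show (k + 1 + 1) / 2 = (k + 1) / 2 by omega,
    Even.neg_one_pow (Nat.even_iff.2 (by omega : (k + 1) % 2 = 0))]
  ring

/-- The factor of the product. -/
noncomputable def fac (j : ℕ) : Polynomial ℤ := 1 + (-1 : Polynomial ℤ) ^ (j - 1) * X ^ (j / 2)

lemma E_prod (k : ℕ) (hk : k % 2 = 1) (I : Finset ℕ) (hI : I ⊆ Finset.range k)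
    (h0 : 0 ∈ I → 2 ≤ k) (d : ℕ) :
    E (k + 2 * d) I 0 = (∏ j ∈ Finset.Icc (k + 1) (k + 2 * d), fac j) ^ 2 * E k I 0 := by
  induction d with
  | zero => simp
  | succ d ih =>
    rw [show k + 2 * (d + 1) = (k + 2 * d) + 2 by ring, E_odd (k + 2 * d) (by omega) I
      (hI.trans (Finset.range_subset_range.2 (by omega))) (fun h => by have := h0 h; omega), ih,
      Finset.prod_Icc_succ_top (by omega), Finset.prod_Icc_succ_top (by omega)]
    have f1 : fac (k + 2 * d + 1) = 1 - X ^ ((k + 2 * d + 1) / 2) := by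
      unfold fac
      rw [Nat.add_sub_cancel, Odd.neg_one_pow (Nat.odd_iff.2 (by omega))]
      ring
    have f2 : fac (k + 2 * d + 1 + 1) = 1 + X ^ ((k + 2 * d + 1) / 2) := by
      unfold fac
      rw [Nat.add_sub_cancel, Even.neg_one_pow (Nat.even_iff.2 (by omega)),
        show (k + 2 * d + 1 + 1) / 2 = (k + 2 * d + 1) / 2 by omega]
      ring
    rw [f1, f2]
    ring

lemma tot_prod (k : ℕ) (hk : k % 2 = 1) (I : Finset ℕ) (hI : I ⊆ Finset.range k)
    (h0 : 0 ∈ I → 2 ≤ k) (n : ℕ) (hn : k ≤ n) :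
    tot n I = (∏ j ∈ Finset.Icc (k + 1) n, fac j) ^ 2 * tot k I := by
  rw [tot_eq k (by omega) I hI h0, E_one_odd k hk, add_zero]
  rw [tot_eq n (by omega) I (hI.trans (Finset.range_subset_range.2 hn))
    (fun h => by have := h0 h; omega)]
  rcases Nat.mod_two_eq_zero_or_one (n - k) with h | h
  · obtain ⟨d, rfl⟩ : ∃ d, n = k + 2 * d := ⟨(n - k) / 2, by omega⟩
    rw [E_one_odd _ (by omega), add_zero, E_prod k hk I hI h0]
  · obtain ⟨d, rfl⟩ : ∃ d, n = k + 2 * d + 1 := ⟨(n - k) / 2, by omega⟩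
    obtain ⟨e1, e2⟩ := E_even (k + 2 * d) (by omega) I
      (hI.trans (Finset.range_subset_range.2 (by omega))) (fun h => by have := h0 h; omega)
    rw [e1, e2, E_prod k hk I hI h0, Finset.prod_Icc_succ_top (by omega)]
    have f1 : fac (k + 2 * d + 1) = 1 - X ^ ((k + 2 * d + 1) / 2) := by
      unfold fac
      rw [Nat.add_sub_cancel, Odd.neg_one_pow (Nat.odd_iff.2 (by omega))]
      ring
    rw [f1]
    ring

/-- Flip the sign of the entry of absolute value one. -/
def flip1 {n : ℕ} (z : Fin n) (σ : SP n) : SP n :=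
  (σ.1, Function.update σ.2 (σ.1.symm z) (!σ.2 (σ.1.symm z)))

lemma flip1_flip1 {n : ℕ} (z : Fin n) (σ : SP n) : flip1 z (flip1 z σ) = σ := by
  unfold flip1
  refine Prod.ext rfl ?_
  simp

lemma flip1_other {n : ℕ} (z : Fin n) (σ : SP n) (i : Fin n) (h : σ.1 i ≠ z) :
    (flip1 z σ).2 i = σ.2 i := by
  unfold flip1
  refine Function.update_of_ne ?_ _ _
  rintro rfl
  exact h (by simp)

lemma flip1_cpair {n : ℕ} (z : Fin n) (hz : (z : ℕ) = 0) (σ : SP n) (i j : Fin n) (hij : i ≠ j) :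
    cpair (sval (flip1 z σ)) ((i : ℕ) + 1) ((j : ℕ) + 1) =
      cpair (sval σ) ((i : ℕ) + 1) ((j : ℕ) + 1) := by
  rw [cpair_fin _ _ _ hij, cpair_fin _ _ _ hij]
  have hne : ((σ.1 i : Fin n) : ℕ) ≠ (σ.1 j : ℕ) := fun h => hij (σ.1.injective (Fin.ext h))
  show (if (σ.1 j : ℕ) < (σ.1 i : ℕ) then 1 else if (flip1 z σ).2 j then 2 else 0) = _
  by_cases h : (σ.1 j : ℕ) < (σ.1 i : ℕ)
  · rw [if_pos h, if_pos h]
  · rw [if_neg h, if_neg h, flip1_other]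
    intro h2
    rw [h2] at h hne
    omega

lemma flip1_wt {n : ℕ} (z : Fin n) (hz : (z : ℕ) = 0) (σ : SP n) : wt (flip1 z σ) = wt σ := by
  have h : ∀ p ∈ pairs n, cpair (sval (flip1 z σ)) p.1 p.2 = cpair (sval σ) p.1 p.2 := by
    rintro ⟨i, j⟩ hp
    obtain ⟨x, y, rfl, rfl, hxy⟩ := pairs_fin hp
    exact flip1_cpair z hz σ x y hxy
  unfold wt
  rw [ellD_eq, ellD_eq, LD_eq, LD_eq, Finset.sum_congr rfl h]
  congr 2
  refine Finset.sum_congr rfl fun p hp => ?_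
  rw [h p hp]

lemma flip1_lt {n : ℕ} (z : Fin n) (hz : (z : ℕ) = 0) (σ : SP n) (i j : Fin n) (hij : i ≠ j) :
    (sval (flip1 z σ) ((i : ℕ) + 1) < sval (flip1 z σ) ((j : ℕ) + 1) ↔
      sval σ ((i : ℕ) + 1) < sval σ ((j : ℕ) + 1)) ∧
    (-sval (flip1 z σ) ((j : ℕ) + 1) < sval (flip1 z σ) ((i : ℕ) + 1) ↔
      -sval σ ((j : ℕ) + 1) < sval σ ((i : ℕ) + 1)) := by
  have hne : ((σ.1 i : Fin n) : ℕ) ≠ (σ.1 j : ℕ) := fun h => hij (σ.1.injective (Fin.ext h))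
  have e : (flip1 z σ).1 = σ.1 := rfl
  rw [sval_lt_iff _ _ _ hij, sval_lt_iff _ _ _ hij, neg_sval_lt_iff _ _ _ hij,
    neg_sval_lt_iff _ _ _ hij, e]
  by_cases h : (σ.1 i : ℕ) < (σ.1 j : ℕ)
  · simp only [if_pos h]
    rw [flip1_other]
    · simp
    · intro h2; rw [h2] at h; omega
  · simp only [if_neg h]
    rw [flip1_other]
    · simp
    · intro h2; rw [h2] at h hne; omega

lemma flip1_InQuot {n : ℕ} (z : Fin n) (hz : (z : ℕ) = 0) (σ : SP n) (I : Finset ℕ)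
    (hI : I ⊆ Finset.range n) (h0 : 0 ∈ I → 2 ≤ n) :
    InQuot (flip1 z σ) I ↔ InQuot σ I := by
  unfold InQuot
  refine forall₂_congr fun i hi => ?_
  have hin : i < n := Finset.mem_range.1 (hI hi)
  unfold dval
  by_cases hi0 : i = 0
  · subst hi0
    have h2 := h0 hi
    exact (flip1_lt z hz σ ⟨0, by omega⟩ ⟨1, by omega⟩ (by simp)).2
  · obtain ⟨m, rfl⟩ : ∃ m, i = m + 1 := ⟨i - 1, by omega⟩
    exact (flip1_lt z hz σ ⟨m, by omega⟩ ⟨m + 1, by omega⟩ (by simp)).1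

lemma flip1_even {n : ℕ} (z : Fin n) (σ : SP n) : IsEvenSP (flip1 z σ) ↔ ¬ IsEvenSP σ := by
  unfold IsEvenSP
  have key : ∀ τ : SP n, (Finset.univ.filter (fun i => τ.2 i = true)).card =
      (if τ.2 (σ.1.symm z) then 1 else 0) +
        ∑ i ∈ Finset.univ.erase (σ.1.symm z), if τ.2 i then 1 else 0 := by
    intro τ
    rw [Finset.card_filter, ← Finset.add_sum_erase _ _ (Finset.mem_univ (σ.1.symm z))]
  rw [key, key]
  have h : ∑ i ∈ Finset.univ.erase (σ.1.symm z), (if (flip1 z σ).2 i then 1 else 0) =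
      ∑ i ∈ Finset.univ.erase (σ.1.symm z), if σ.2 i then 1 else 0 := by
    refine Finset.sum_congr rfl fun i hi => ?_
    rw [flip1_other]
    intro h
    exact (Finset.mem_erase.1 hi).1 (by rw [← h]; simp)
  have h2 : (flip1 z σ).2 (σ.1.symm z) = !σ.2 (σ.1.symm z) := by simp [flip1]
  rw [h, h2, Nat.even_iff, Nat.even_iff]
  cases σ.2 (σ.1.symm z) <;> simp <;> omega

lemma two_genD (n : ℕ) (hn : 1 ≤ n) (I : Finset ℕ) (hI : I ⊆ Finset.range n)
    (h0 : 0 ∈ I → 2 ≤ n) : tot n I = 2 * genD n I := by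
  have hz : ((⟨0, by omega⟩ : Fin n) : ℕ) = 0 := rfl
  generalize (⟨0, by omega⟩ : Fin n) = z at hz
  have h1 : genD n I = ∑ σ ∈ (Finset.univ.filter (fun σ : SP n => InQuot σ I)).filter
      (fun σ => IsEvenSP σ), wt σ := by
    unfold genD wt
    rw [Finset.filter_filter]
    refine Finset.sum_congr ?_ fun _ _ => rfl
    ext σ
    simp only [Finset.mem_filter, and_comm]
  have h2 : ∑ σ ∈ (Finset.univ.filter (fun σ : SP n => InQuot σ I)).filter
      (fun σ => ¬ IsEvenSP σ), wt σ =
      ∑ σ ∈ (Finset.univ.filter (fun σ : SP n => InQuot σ I)).filter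
      (fun σ => IsEvenSP σ), wt σ := by
    refine Finset.sum_bij' (fun σ _ => flip1 z σ) (fun σ _ => flip1 z σ) ?_ ?_
      (fun σ _ => flip1_flip1 z σ) (fun σ _ => flip1_flip1 z σ)
      (fun σ _ => (flip1_wt z hz σ).symm)
    · intro σ hσ
      simp only [Finset.mem_filter, Finset.mem_univ, true_and] at hσ ⊢
      exact ⟨(flip1_InQuot z hz σ I hI h0).2 hσ.1, (flip1_even z σ).2 hσ.2⟩
    · intro σ hσ
      simp only [Finset.mem_filter, Finset.mem_univ, true_and] at hσ ⊢
      exact ⟨(flip1_InQuot z hz σ I hI h0).2 hσ.1,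
        fun h => (flip1_even z σ).1 h hσ.2⟩
  unfold tot
  rw [← Finset.sum_filter_add_sum_filter_not _ (fun σ => IsEvenSP σ) wt, h2, ← h1]
  ring

lemma reduce' (n : ℕ) (I : Finset ℕ) (hI : I ⊆ Finset.range n) :
    ∃ I' : Finset ℕ, I' ⊆ Finset.range (2 * mI I + 1) ∧ tot n I' = tot n I ∧
      (0 ∈ I' → 2 ≤ 2 * mI I + 1) := by
  rcases Nat.eq_zero_or_pos (mI I) with hm | hm
  · have hempty : I = ∅ := by
      rw [Finset.eq_empty_iff_forall_notMem]
      intro i hi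
      obtain ⟨s, hs⟩ := exists_start I i hi
      have hsI : s ∈ I := hs.2.1 s le_rfl hs.1
      have hss : Start I s s := ⟨le_rfl, fun j h1 h2 => by
        rw [show j = s by omega]; exact hsI, hs.2.2⟩
      have h1 := cnt_pos I hsI ((sel_iff hss).2 (by simp))
      have h2 := cnt_le I s
      omega
    refine ⟨I, ?_, rfl, ?_⟩
    · rw [hempty]; simp
    · intro h; rw [hempty] at h; simp at h
  · obtain ⟨I', h1, h2⟩ := reduce n _ I rfl hI
    exact ⟨I', h1, h2, fun _ => by omega⟩

/-- Corollary 5.7: `∏_{j=2m_I+2}^{n} (1 + (-1)^{j-1} x^{⌊j/2⌋})²` divides `D_n^I(x)`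
in `ℤ[x]`. -/
theorem stmt19 (n : ℕ) (hn : 3 ≤ n) (I : Finset ℕ) (hI : I ⊆ Finset.range n) :
    (∏ j ∈ Finset.Icc (2 * mI I + 2) n,
        (1 + (-1 : Polynomial ℤ) ^ (j - 1) * X ^ (j / 2))) ^ 2 ∣ genD n I := by
  by_cases hle : n ≤ 2 * mI I + 1
  · rw [Finset.Icc_eq_empty (by omega)]
    simp
  · obtain ⟨I', h1, h2, h3⟩ := reduce' n I hI
    have hk : 2 * mI I + 1 ≤ n := by omega
    have e1 := two_genD n (by omega) I hI (fun _ => by omega)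
    have e2 := two_genD (2 * mI I + 1) (by omega) I' h1 h3
    have e3 := tot_prod (2 * mI I + 1) (by omega) I' h1 h3 n hk
    rw [h2, e1, e2] at e3
    refine ⟨genD (2 * mI I + 1) I', ?_⟩
    have h4 : (2 : Polynomial ℤ) ≠ 0 := two_ne_zero
    apply mul_left_cancel₀ h4
    rw [e3]
    unfold fac
    ring

end OddLength
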